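/- In the resolvent-sequence setting, define for 0 < α₁ < α₂ < β the quantity Jₙ(α₁, α₂) := ∫₀^{α₁} ( ρ₁ λₙ² |v¹ₙ|² + k₁ |v¹ₙ′|² + ρ₂ λₙ² |v³ₙ|² + k₂ |v³ₙ′|² + k₃ |v⁵ₙ′|² ) dx + ∫_{α₂}^{L} ( ρ₁ λₙ² |v¹ₙ|² + k₁ |v¹ₙ′|² + ρ₂ λₙ² |v³ₙ|² + k₂ |v³ₙ′|² + k₃ |v⁵ₙ′|² ) dx + ρ₁ λₙ² ∫_β^L |v⁵ₙ|² dx. If (H2) holds, then for every ε with 0 < ε < β/12: Jₙ(5ε, β−5ε) → 0 as n → ∞. -/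

import Mathlib

open Set Filter MeasureTheory

noncomputable section

/-- The resolvent-sequence setting for the locally damped Bresse system with
parameter `ℓ`: a sequence of nonzero frequencies `lam n` with `|lam n| → ∞`,
solutions `Uₙ = (v1,…,v6)` and right-hand sides `Fₙ = (f1,…,f6)` of the resolvent
equations `(lam n)^ℓ (i (lam n) I − 𝒜) Uₙ = Fₙ`, with `‖Uₙ‖_H = 1` and `‖Fₙ‖_H → 0`. -/
structure BresseSetting (ρ₁ ρ₂ k₁ k₂ k₃ l L β a₀ : ℝ) (ℓ : ℕ) where
  lam : ℕ → ℝ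
  v1 : ℕ → ℝ → ℂ
  v2 : ℕ → ℝ → ℂ
  v3 : ℕ → ℝ → ℂ
  v4 : ℕ → ℝ → ℂ
  v5 : ℕ → ℝ → ℂ
  v6 : ℕ → ℝ → ℂ
  f1 : ℕ → ℝ → ℂ
  f2 : ℕ → ℝ → ℂ
  f3 : ℕ → ℝ → ℂ
  f4 : ℕ → ℝ → ℂ
  f5 : ℕ → ℝ → ℂ
  f6 : ℕ → ℝ → ℂ
  lam_ne : ∀ n, lam n ≠ 0
  lam_tendsto : Tendsto (fun n => |lam n|) atTop atTop
  reg_v1 : ∀ n, ContDiffOn ℝ 2 (v1 n) (Icc 0 L)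
  reg_v3 : ∀ n, ContDiffOn ℝ 2 (v3 n) (Icc 0 L)
  reg_v5 : ∀ n, ContDiffOn ℝ 1 (v5 n) (Icc 0 L)
  reg_v5_left : ∀ n, ContDiffOn ℝ 2 (v5 n) (Icc 0 β)
  reg_v5_right : ∀ n, ContDiffOn ℝ 2 (v5 n) (Icc β L)
  reg_v2 : ∀ n, ContDiffOn ℝ 1 (v2 n) (Icc 0 L)
  reg_v4 : ∀ n, ContDiffOn ℝ 1 (v4 n) (Icc 0 L)
  reg_v6 : ∀ n, ContDiffOn ℝ 1 (v6 n) (Icc 0 L)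
  reg_f1 : ∀ n, ContDiffOn ℝ 1 (f1 n) (Icc 0 L)
  reg_f3 : ∀ n, ContDiffOn ℝ 1 (f3 n) (Icc 0 L)
  reg_f5 : ∀ n, ContDiffOn ℝ 1 (f5 n) (Icc 0 L)
  reg_f2 : ∀ n, ContinuousOn (f2 n) (Icc 0 L)
  reg_f4 : ∀ n, ContinuousOn (f4 n) (Icc 0 L)
  reg_f6 : ∀ n, ContinuousOn (f6 n) (Icc 0 L)
  bc_zero : ∀ n, v1 n 0 = 0 ∧ v2 n 0 = 0 ∧ v3 n 0 = 0 ∧ v4 n 0 = 0 ∧ v5 n 0 = 0 ∧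
      v6 n 0 = 0 ∧ f1 n 0 = 0 ∧ f3 n 0 = 0 ∧ f5 n 0 = 0
  bc_L : ∀ n, v1 n L = 0 ∧ v2 n L = 0 ∧ v3 n L = 0 ∧ v4 n L = 0 ∧ v5 n L = 0 ∧
      v6 n L = 0 ∧ f1 n L = 0 ∧ f3 n L = 0 ∧ f5 n L = 0
  eq1 : ∀ n, ∀ x ∈ Ioo (0 : ℝ) β ∪ Ioo β L,
      Complex.I * (lam n : ℂ) * v1 n x - v2 n x = (lam n : ℂ) ^ (-(ℓ : ℤ)) * f1 n x
  eq2 : ∀ n, ∀ x ∈ Ioo (0 : ℝ) β ∪ Ioo β L,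
      Complex.I * (lam n : ℂ) * (ρ₁ : ℂ) * v2 n x
        - (k₁ : ℂ) * deriv (fun y => deriv (v1 n) y + v3 n y + (l : ℂ) * v5 n y) x
        - (l : ℂ) * (k₃ : ℂ) * (deriv (v5 n) x - (l : ℂ) * v1 n x)
        = (ρ₁ : ℂ) * (lam n : ℂ) ^ (-(ℓ : ℤ)) * f2 n x
  eq3 : ∀ n, ∀ x ∈ Ioo (0 : ℝ) β ∪ Ioo β L,
      Complex.I * (lam n : ℂ) * v3 n x - v4 n x = (lam n : ℂ) ^ (-(ℓ : ℤ)) * f3 n x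
  eq4 : ∀ n, ∀ x ∈ Ioo (0 : ℝ) β ∪ Ioo β L,
      Complex.I * (lam n : ℂ) * (ρ₂ : ℂ) * v4 n x
        - (k₂ : ℂ) * deriv (deriv (v3 n)) x
        + (k₁ : ℂ) * (deriv (v1 n) x + v3 n x + (l : ℂ) * v5 n x)
        = (ρ₂ : ℂ) * (lam n : ℂ) ^ (-(ℓ : ℤ)) * f4 n x
  eq5 : ∀ n, ∀ x ∈ Ioo (0 : ℝ) β ∪ Ioo β L,
      Complex.I * (lam n : ℂ) * v5 n x - v6 n x = (lam n : ℂ) ^ (-(ℓ : ℤ)) * f5 n x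
  eq6 : ∀ n, ∀ x ∈ Ioo (0 : ℝ) β ∪ Ioo β L,
      Complex.I * (lam n : ℂ) * (ρ₁ : ℂ) * v6 n x
        - (k₃ : ℂ) * deriv (fun y => deriv (v5 n) y - (l : ℂ) * v1 n y) x
        + (l : ℂ) * (k₁ : ℂ) * (deriv (v1 n) x + v3 n x + (l : ℂ) * v5 n x)
        + (if x < β then (a₀ : ℂ) else 0) * v6 n x
        = (ρ₁ : ℂ) * (lam n : ℂ) ^ (-(ℓ : ℤ)) * f6 n x
  normU : ∀ n, (∫ x in (0 : ℝ)..L,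
      (k₁ * ‖deriv (v1 n) x + v3 n x + (l : ℂ) * v5 n x‖ ^ 2 + ρ₁ * ‖v2 n x‖ ^ 2
        + k₂ * ‖deriv (v3 n) x‖ ^ 2 + ρ₂ * ‖v4 n x‖ ^ 2
        + k₃ * ‖deriv (v5 n) x - (l : ℂ) * v1 n x‖ ^ 2 + ρ₁ * ‖v6 n x‖ ^ 2)) = 1
  normF : Tendsto (fun n => ∫ x in (0 : ℝ)..L,
      (k₁ * ‖deriv (f1 n) x + f3 n x + (l : ℂ) * f5 n x‖ ^ 2 + ρ₁ * ‖f2 n x‖ ^ 2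
        + k₂ * ‖deriv (f3 n) x‖ ^ 2 + ρ₂ * ‖f4 n x‖ ^ 2
        + k₃ * ‖deriv (f5 n) x - (l : ℂ) * f1 n x‖ ^ 2 + ρ₁ * ‖f6 n x‖ ^ 2))
      atTop (nhds 0)

/-! ### A small calculus of bounded / vanishing sequences in `L²(a,b)` -/

/-- real part of `z * conj w` -/
def brIp (z w : ℂ) : ℝ := z.re * w.re + z.im * w.im

lemma brIp_self (z : ℂ) : brIp z z = ‖z‖ ^ 2 := by
  rw [← Complex.normSq_eq_norm_sq, Complex.normSq_apply, brIp]

lemma brIp_comm (z w : ℂ) : brIp z w = brIp w z := by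
  simp only [brIp]; ring

lemma brIp_abs_le (z w : ℂ) : |brIp z w| ≤ ‖z‖ * ‖w‖ := by
  have h1 : (brIp z w) ^ 2 ≤ (‖z‖ * ‖w‖) ^ 2 := by
    rw [mul_pow, ← brIp_self, ← brIp_self]
    simp only [brIp]
    nlinarith [sq_nonneg (z.re * w.im - z.im * w.re)]
  exact abs_le_of_sq_le_sq h1 (by positivity)

lemma brIp_continuous {A B : ℝ → ℂ} (hA : Continuous A) (hB : Continuous B) :
    Continuous (fun x => brIp (A x) (B x)) := by
  unfold brIp
  have h1 := Complex.continuous_re.comp hA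
  have h2 := Complex.continuous_re.comp hB
  have h3 := Complex.continuous_im.comp hA
  have h4 := Complex.continuous_im.comp hB
  exact (h1.mul h2).add (h3.mul h4)

lemma brIp_hasDerivAt {A B : ℝ → ℂ} {A' B' : ℂ} {x : ℝ} (hA : HasDerivAt A A' x)
    (hB : HasDerivAt B B' x) :
    HasDerivAt (fun y => brIp (A y) (B y)) (brIp A' (B x) + brIp (A x) B') x := by
  have hre : ∀ {C : ℝ → ℂ} {C' : ℂ}, HasDerivAt C C' x →
      HasDerivAt (fun y => (C y).re) C'.re x := fun h => by
    exact Complex.reCLM.hasFDerivAt.comp_hasDerivAt x h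
  have him : ∀ {C : ℝ → ℂ} {C' : ℂ}, HasDerivAt C C' x →
      HasDerivAt (fun y => (C y).im) C'.im x := fun h => by
    exact Complex.imCLM.hasFDerivAt.comp_hasDerivAt x h
  have := ((hre hA).mul (hre hB)).add ((him hA).mul (him hB))
  refine this.congr_deriv ?_
  simp only [brIp]; ring

lemma br_cs {a b : ℝ} (hab : a ≤ b) {f g : ℝ → ℝ} (hf : Continuous f) (hg : Continuous g) :
    (∫ x in a..b, f x * g x) ^ 2 ≤ (∫ x in a..b, f x ^ 2) * (∫ x in a..b, g x ^ 2) := by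
  have h : ∀ t : ℝ, 0 ≤ (∫ x in a..b, f x ^ 2) * (t * t) + (2 * ∫ x in a..b, f x * g x) * t
      + (∫ x in a..b, g x ^ 2) := by
    intro t
    have h0 : 0 ≤ ∫ x in a..b, (f x * t + g x) ^ 2 :=
      intervalIntegral.integral_nonneg hab (fun x _ => sq_nonneg _)
    have h1 : (∫ x in a..b, (f x * t + g x) ^ 2) =
        ∫ x in a..b, ((t * t) * f x ^ 2 + ((2 * t) * (f x * g x) + g x ^ 2)) :=
      intervalIntegral.integral_congr (fun x _ => by ring)
    rw [h1, intervalIntegral.integral_add, intervalIntegral.integral_add,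
      intervalIntegral.integral_const_mul, intervalIntegral.integral_const_mul] at h0
    · linarith
    all_goals exact Continuous.intervalIntegrable (by fun_prop) _ _
  have := discrim_le_zero h
  unfold discrim at this
  nlinarith

/-- bounded in `L²(a,b)` -/
def BrO (a b : ℝ) (A : ℕ → ℝ → ℂ) : Prop :=
  (∀ n, Continuous (A n)) ∧ ∃ C, ∀ n, ∫ x in a..b, ‖A n x‖ ^ 2 ≤ C

/-- tends to zero in `L²(a,b)` -/
def Bro (a b : ℝ) (A : ℕ → ℝ → ℂ) : Prop :=
  (∀ n, Continuous (A n)) ∧ Tendsto (fun n => ∫ x in a..b, ‖A n x‖ ^ 2) atTop (nhds 0)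

/-- real functions with integral tending to zero -/
def BrT (a b : ℝ) (Z : ℕ → ℝ → ℝ) : Prop :=
  (∀ n, Continuous (Z n)) ∧ Tendsto (fun n => ∫ x in a..b, Z n x) atTop (nhds 0)

lemma br_nn {a b : ℝ} (hab : a ≤ b) (A : ℝ → ℂ) : 0 ≤ ∫ x in a..b, ‖A x‖ ^ 2 :=
  intervalIntegral.integral_nonneg hab (fun x _ => sq_nonneg _)

lemma br_add_le {a b : ℝ} (hab : a ≤ b) {A B : ℝ → ℂ} (hA : Continuous A) (hB : Continuous B) :
    ∫ x in a..b, ‖A x + B x‖ ^ 2 ≤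
      2 * (∫ x in a..b, ‖A x‖ ^ 2) + 2 * ∫ x in a..b, ‖B x‖ ^ 2 := by
  rw [← intervalIntegral.integral_const_mul, ← intervalIntegral.integral_const_mul,
    ← intervalIntegral.integral_add]
  · apply intervalIntegral.integral_mono_on hab
    · exact Continuous.intervalIntegrable (by fun_prop) _ _
    · exact Continuous.intervalIntegrable (by fun_prop) _ _
    · intro x _
      have h1 := norm_add_le (A x) (B x)
      have h2 := norm_nonneg (A x + B x)
      nlinarith [sq_nonneg (‖A x‖ - ‖B x‖)]
  all_goals exact Continuous.intervalIntegrable (by fun_prop) _ _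

lemma br_mul_le {a b : ℝ} (hab : a ≤ b) {w : ℝ → ℂ} (hw : Continuous w) :
    ∃ M, 0 ≤ M ∧ ∀ A : ℝ → ℂ, Continuous A →
      ∫ x in a..b, ‖w x * A x‖ ^ 2 ≤ M * ∫ x in a..b, ‖A x‖ ^ 2 := by
  obtain ⟨M, hM⟩ := (isCompact_Icc (a := a) (b := b)).exists_bound_of_continuousOn hw.continuousOn
  refine ⟨M ^ 2, sq_nonneg _, fun A hA => ?_⟩
  rw [← intervalIntegral.integral_const_mul]
  apply intervalIntegral.integral_mono_on hab
  · exact Continuous.intervalIntegrable (by fun_prop) _ _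
  · exact Continuous.intervalIntegrable (by fun_prop) _ _
  · intro x hx
    rw [norm_mul, mul_pow]
    have := hM x hx
    gcongr

lemma Bro.congr {a b : ℝ} {A B : ℕ → ℝ → ℂ} (hA : Bro a b A) (h : ∀ n x, B n x = A n x) :
    Bro a b B := by
  have : B = A := by funext n x; exact h n x
  rwa [this]

lemma BrO.congr {a b : ℝ} {A B : ℕ → ℝ → ℂ} (hA : BrO a b A) (h : ∀ n x, B n x = A n x) :
    BrO a b B := by
  have : B = A := by funext n x; exact h n x
  rwa [this]

lemma BrT.congr {a b : ℝ} {A B : ℕ → ℝ → ℝ} (hA : BrT a b A) (h : ∀ n x, B n x = A n x) :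
    BrT a b B := by
  have : B = A := by funext n x; exact h n x
  rwa [this]

lemma Bro.toO {a b : ℝ} {A : ℕ → ℝ → ℂ} (hA : Bro a b A) : BrO a b A := by
  refine ⟨hA.1, ?_⟩
  obtain ⟨C, hC⟩ := hA.2.bddAbove_range
  exact ⟨C, fun n => hC ⟨n, rfl⟩⟩

lemma BrO.add {a b : ℝ} (hab : a ≤ b) {A B : ℕ → ℝ → ℂ} (hA : BrO a b A) (hB : BrO a b B) :
    BrO a b (fun n x => A n x + B n x) := by
  obtain ⟨hA, C, hC⟩ := hA
  obtain ⟨hB, C', hC'⟩ := hB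
  refine ⟨fun n => (hA n).add (hB n), 2 * C + 2 * C', fun n => ?_⟩
  have := br_add_le hab (hA n) (hB n)
  linarith [hC n, hC' n]

lemma Bro.add {a b : ℝ} (hab : a ≤ b) {A B : ℕ → ℝ → ℂ} (hA : Bro a b A) (hB : Bro a b B) :
    Bro a b (fun n x => A n x + B n x) := by
  refine ⟨fun n => (hA.1 n).add (hB.1 n), ?_⟩
  refine squeeze_zero (fun n => br_nn hab _) (fun n => br_add_le hab (hA.1 n) (hB.1 n)) ?_
  simpa using (hA.2.const_mul 2).add (hB.2.const_mul 2)

lemma BrO.mulc {a b : ℝ} (hab : a ≤ b) {A : ℕ → ℝ → ℂ} (hA : BrO a b A) {w : ℝ → ℂ}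
    (hw : Continuous w) : BrO a b (fun n x => w x * A n x) := by
  obtain ⟨hA, C, hC⟩ := hA
  obtain ⟨M, hM, h⟩ := br_mul_le hab hw
  refine ⟨fun n => hw.mul (hA n), M * C, fun n => (h _ (hA n)).trans ?_⟩
  exact mul_le_mul_of_nonneg_left (hC n) hM

lemma Bro.mulc {a b : ℝ} (hab : a ≤ b) {A : ℕ → ℝ → ℂ} (hA : Bro a b A) {w : ℝ → ℂ}
    (hw : Continuous w) : Bro a b (fun n x => w x * A n x) := by
  obtain ⟨M, hM, h⟩ := br_mul_le hab hw
  refine ⟨fun n => hw.mul (hA.1 n), ?_⟩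
  refine squeeze_zero (fun n => br_nn hab _) (fun n => h _ (hA.1 n)) ?_
  simpa using hA.2.const_mul M

lemma BrO.smul {a b : ℝ} (hab : a ≤ b) {A : ℕ → ℝ → ℂ} (hA : BrO a b A) (c : ℂ) :
    BrO a b (fun n x => c * A n x) := hA.mulc hab (w := fun _ => c) continuous_const

lemma Bro.smul {a b : ℝ} (hab : a ≤ b) {A : ℕ → ℝ → ℂ} (hA : Bro a b A) (c : ℂ) :
    Bro a b (fun n x => c * A n x) := hA.mulc hab (w := fun _ => c) continuous_const

lemma BrO.small {a b : ℝ} (hab : a ≤ b) {A : ℕ → ℝ → ℂ} (hA : BrO a b A) {c : ℕ → ℝ}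
    (hc : Tendsto c atTop (nhds 0)) : Bro a b (fun n x => (c n : ℂ) * A n x) := by
  obtain ⟨hA, C, hC⟩ := hA
  refine ⟨fun n => continuous_const.mul (hA n), ?_⟩
  refine squeeze_zero (g := fun n => c n ^ 2 * C) (fun n => br_nn hab _) (fun n => ?_) ?_
  · have : ∫ x in a..b, ‖(c n : ℂ) * A n x‖ ^ 2 = c n ^ 2 * ∫ x in a..b, ‖A n x‖ ^ 2 := by
      rw [← intervalIntegral.integral_const_mul]
      refine intervalIntegral.integral_congr (fun x _ => ?_)
      simp [mul_pow]
    rw [this]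
    exact mul_le_mul_of_nonneg_left (hC n) (sq_nonneg _)
  · simpa using (hc.pow 2).mul_const C

lemma BrO.mono {a b c d : ℝ} (hac : c ≤ a) (hab : a ≤ b) (hbd : b ≤ d) {A : ℕ → ℝ → ℂ}
    (hA : BrO c d A) : BrO a b A := by
  obtain ⟨hA, C, hC⟩ := hA
  refine ⟨hA, C, fun n => le_trans ?_ (hC n)⟩
  have := hA n
  exact intervalIntegral.integral_mono_interval hac hab hbd
    (Eventually.of_forall fun x => sq_nonneg _)
    (Continuous.intervalIntegrable (by fun_prop) _ _)

lemma Bro.mono {a b c d : ℝ} (hac : c ≤ a) (hab : a ≤ b) (hbd : b ≤ d) {A : ℕ → ℝ → ℂ}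
    (hA : Bro c d A) : Bro a b A := by
  refine ⟨hA.1, squeeze_zero (fun n => br_nn hab _) (fun n => ?_) hA.2⟩
  have := hA.1 n
  exact intervalIntegral.integral_mono_interval hac hab hbd
    (Eventually.of_forall fun x => sq_nonneg _)
    (Continuous.intervalIntegrable (by fun_prop) _ _)

lemma BrT.add {a b : ℝ} {A B : ℕ → ℝ → ℝ} (hA : BrT a b A) (hB : BrT a b B) :
    BrT a b (fun n x => A n x + B n x) := by
  refine ⟨fun n => (hA.1 n).add (hB.1 n), ?_⟩
  have h : ∀ n, ∫ x in a..b, (A n x + B n x) = (∫ x in a..b, A n x) + ∫ x in a..b, B n x :=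
    fun n => intervalIntegral.integral_add ((hA.1 n).intervalIntegrable _ _)
      ((hB.1 n).intervalIntegrable _ _)
  simp only [h]
  simpa using hA.2.add hB.2

lemma BrT.smul {a b : ℝ} {A : ℕ → ℝ → ℝ} (hA : BrT a b A) (c : ℝ) :
    BrT a b (fun n x => c * A n x) := by
  refine ⟨fun n => continuous_const.mul (hA.1 n), ?_⟩
  simp only [intervalIntegral.integral_const_mul]
  simpa using hA.2.const_mul c

lemma BrO.ip {a b : ℝ} (hab : a ≤ b) {A B : ℕ → ℝ → ℂ} (hA : BrO a b A) (hB : Bro a b B) :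
    BrT a b (fun n x => brIp (A n x) (B n x)) := by
  obtain ⟨hA, C, hC⟩ := hA
  refine ⟨fun n => brIp_continuous (hA n) (hB.1 n), ?_⟩
  have key : ∀ n, |∫ x in a..b, brIp (A n x) (B n x)| ≤
      Real.sqrt (C * ∫ x in a..b, ‖B n x‖ ^ 2) := by
    intro n
    have hAn := hA n
    have hBn := hB.1 n
    apply Real.le_sqrt_of_sq_le
    have h1 : |∫ x in a..b, brIp (A n x) (B n x)| ≤ ∫ x in a..b, ‖A n x‖ * ‖B n x‖ := by
      refine (intervalIntegral.abs_integral_le_integral_abs hab).trans ?_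
      apply intervalIntegral.integral_mono_on hab
      · exact ((brIp_continuous hAn hBn).abs).intervalIntegrable _ _
      · exact Continuous.intervalIntegrable (by fun_prop) _ _
      · intro x _
        exact brIp_abs_le _ _
    have h2 := br_cs hab hAn.norm hBn.norm
    calc _ ≤ (∫ x in a..b, ‖A n x‖ * ‖B n x‖) ^ 2 := by
          exact pow_le_pow_left₀ (abs_nonneg _) h1 2
      _ ≤ _ := h2
      _ ≤ _ := mul_le_mul_of_nonneg_right (hC n) (br_nn hab _)
  refine squeeze_zero_norm (fun n => key n) ?_
  have := (hB.2.const_mul C).sqrt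
  simpa using this

lemma Bro.ip {a b : ℝ} (hab : a ≤ b) {A B : ℕ → ℝ → ℂ} (hA : Bro a b A) (hB : BrO a b B) :
    BrT a b (fun n x => brIp (A n x) (B n x)) :=
  (hB.ip hab hA).congr (fun _ _ => brIp_comm _ _)

lemma Bro.of_key {a b : ℝ} {X : ℕ → ℝ → ℂ} {D Z : ℕ → ℝ → ℝ} {K : ℝ}
    (hK : 0 < K) (hX : ∀ n, Continuous (X n)) (hDc : ∀ n, Continuous (D n))
    (hD : ∀ n, ∫ x in a..b, D n x = 0) (hZ : BrT a b Z)
    (h : ∀ n x, K * ‖X n x‖ ^ 2 = D n x + Z n x) : Bro a b X := by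
  refine ⟨hX, ?_⟩
  have e : ∀ n, ∫ x in a..b, ‖X n x‖ ^ 2 = K⁻¹ * ∫ x in a..b, Z n x := by
    intro n
    have h1 : K * ∫ x in a..b, ‖X n x‖ ^ 2 = ∫ x in a..b, (D n x + Z n x) := by
      rw [← intervalIntegral.integral_const_mul]
      exact intervalIntegral.integral_congr (fun x _ => h n x)
    rw [intervalIntegral.integral_add ((hDc n).intervalIntegrable _ _)
      ((hZ.1 n).intervalIntegrable _ _), hD n, zero_add] at h1
    rw [← h1]; field_simp
  simp only [e]
  simpa using hZ.2.const_mul K⁻¹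

lemma br_ftc {a b : ℝ} (hab : a ≤ b) {F F' : ℝ → ℝ} (hF : Continuous F) (hF' : Continuous F')
    (h : ∀ x ∈ Ioo a b, HasDerivAt F (F' x) x) : ∫ x in a..b, F' x = F b - F a :=
  intervalIntegral.integral_eq_sub_of_hasDerivAt_of_le hab hF.continuousOn h
    (hF'.intervalIntegrable _ _)

/-- Poincare-type lemma. -/
lemma Bro.poincare {L κ : ℝ} (hL : 0 ≤ L) {y G : ℕ → ℝ → ℂ} (hG : Bro 0 L G)
    (hy : ∀ n, Continuous (y n)) (hy0 : ∀ n, y n 0 = 0)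
    (hd : ∀ n, ∀ x ∈ Ioo 0 L, HasDerivAt (y n) (G n x + Complex.I * κ * y n x) x) :
    Bro 0 L y := by
  refine ⟨hy, ?_⟩
  refine squeeze_zero (g := fun n => L * (L * ∫ x in (0:ℝ)..L, ‖G n x‖ ^ 2))
    (fun n => br_nn hL _) (fun n => ?_) (by simpa using (hG.2.const_mul L).const_mul L)
  have hGn := hG.1 n
  have hyn := hy n
  have hexp : ∀ x : ℝ, ‖Complex.exp (-(Complex.I * κ * x))‖ = 1 := by
    intro x
    rw [Complex.norm_exp]; simp
  have hb : ∀ x ∈ Icc 0 L, ‖y n x‖ ^ 2 ≤ L * ∫ x in (0:ℝ)..L, ‖G n x‖ ^ 2 := by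
    intro x hx
    have hE : ∫ t in (0:ℝ)..x, Complex.exp (-(Complex.I * κ * t)) * G n t =
        Complex.exp (-(Complex.I * κ * x)) * y n x -
          Complex.exp (-(Complex.I * κ * (0:ℝ))) * y n 0 := by
      refine intervalIntegral.integral_eq_sub_of_hasDerivAt_of_le
        (f := fun t : ℝ => Complex.exp (-(Complex.I * κ * t)) * y n t) hx.1 ?_ ?_ ?_
      · exact Continuous.continuousOn (by fun_prop)
      · intro t ht
        have h1 : HasDerivAt (fun t : ℝ => Complex.exp (-(Complex.I * κ * t)))
            (Complex.exp (-(Complex.I * κ * t)) * (-(Complex.I * κ * 1))) t := by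
          have : HasDerivAt (fun t : ℝ => (t : ℂ)) 1 t := Complex.ofRealCLM.hasDerivAt
          exact ((this.const_mul (Complex.I * κ)).neg).cexp
        have h2 := h1.mul (hd n t ⟨ht.1, ht.2.trans_le hx.2⟩)
        refine h2.congr_deriv ?_
        ring
      · exact Continuous.intervalIntegrable (by fun_prop) _ _
    rw [hy0 n, mul_zero, sub_zero] at hE
    have h1 : ‖y n x‖ ≤ ∫ t in (0:ℝ)..L, ‖G n t‖ * 1 := by
      calc ‖y n x‖ = ‖Complex.exp (-(Complex.I * κ * x)) * y n x‖ := by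
            rw [norm_mul, hexp, one_mul]
        _ = ‖∫ t in (0:ℝ)..x, Complex.exp (-(Complex.I * κ * t)) * G n t‖ := by rw [hE]
        _ ≤ ∫ t in (0:ℝ)..x, ‖Complex.exp (-(Complex.I * κ * t)) * G n t‖ :=
            intervalIntegral.norm_integral_le_integral_norm hx.1
        _ = ∫ t in (0:ℝ)..x, ‖G n t‖ * 1 := by
            refine intervalIntegral.integral_congr (fun t _ => ?_)
            simp only [norm_mul, hexp, one_mul, mul_one]
        _ ≤ _ := by
            refine intervalIntegral.integral_mono_interval le_rfl hx.1 hx.2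
              (Eventually.of_forall fun x => ?_)
              (Continuous.intervalIntegrable (by fun_prop) _ _)
            simp
    have h2 := br_cs hL hGn.norm (continuous_const (y := (1:ℝ)))
    have h3 : ∫ x in (0:ℝ)..L, (1:ℝ) ^ 2 = L := by simp
    rw [h3] at h2
    calc ‖y n x‖ ^ 2 ≤ _ := pow_le_pow_left₀ (norm_nonneg _) h1 2
      _ ≤ _ := h2
      _ = _ := mul_comm _ _
  calc ∫ x in (0:ℝ)..L, ‖y n x‖ ^ 2 ≤ ∫ _x in (0:ℝ)..L, L * ∫ x in (0:ℝ)..L, ‖G n x‖ ^ 2 := by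
        apply intervalIntegral.integral_mono_on hL
        · exact Continuous.intervalIntegrable (by fun_prop) _ _
        · exact Continuous.intervalIntegrable (by fun_prop) _ _
        · exact hb
    _ = _ := by simp

/-! ### Abstract cleaned-up data -/

/-- cleaned-up (globally continuous) data -/
structure BrD where
  ρ₁ : ℝ
  ρ₂ : ℝ
  k₁ : ℝ
  k₂ : ℝ
  k₃ : ℝ
  l : ℝ
  hρ₁ : 0 < ρ₁
  hρ₂ : 0 < ρ₂
  hk₁ : 0 < k₁
  hk₂ : 0 < k₂
  hk₃ : 0 < k₃
  hl : 0 < l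
  lam : ℕ → ℝ
  lam_ne : ∀ n, lam n ≠ 0
  lam_tendsto : Tendsto (fun n => |lam n|) atTop atTop
  u1 : ℕ → ℝ → ℂ
  p1 : ℕ → ℝ → ℂ
  u3 : ℕ → ℝ → ℂ
  p3 : ℕ → ℝ → ℂ
  u5 : ℕ → ℝ → ℂ
  p5 : ℕ → ℝ → ℂ
  f1 : ℕ → ℝ → ℂ
  g1 : ℕ → ℝ → ℂ
  f3 : ℕ → ℝ → ℂ
  g3 : ℕ → ℝ → ℂ
  f5 : ℕ → ℝ → ℂ
  g5 : ℕ → ℝ → ℂ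
  f2 : ℕ → ℝ → ℂ
  f4 : ℕ → ℝ → ℂ
  f6 : ℕ → ℝ → ℂ

namespace BrD

variable (D : BrD)

def mu (n : ℕ) : ℝ := (D.lam n)⁻¹

lemma mu_tendsto : Tendsto D.mu atTop (nhds 0) := by
  have h : Tendsto (fun n => |D.lam n|⁻¹) atTop (nhds 0) := tendsto_inv_atTop_zero.comp D.lam_tendsto
  rw [tendsto_zero_iff_norm_tendsto_zero]
  simpa [mu] using h

lemma lam_mu (n : ℕ) : (D.lam n : ℂ) * (D.mu n : ℂ) = 1 := by
  have : D.lam n * D.mu n = 1 := mul_inv_cancel₀ (D.lam_ne n)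
  exact_mod_cast this

def v2 (n : ℕ) (x : ℝ) : ℂ := Complex.I * D.lam n * D.u1 n x - (D.mu n) ^ 2 * D.f1 n x
def v4 (n : ℕ) (x : ℝ) : ℂ := Complex.I * D.lam n * D.u3 n x - (D.mu n) ^ 2 * D.f3 n x
def v6 (n : ℕ) (x : ℝ) : ℂ := Complex.I * D.lam n * D.u5 n x - (D.mu n) ^ 2 * D.f5 n x

def r1 (n : ℕ) (x : ℝ) : ℂ :=
  D.ρ₁ * ((D.mu n) * ((D.mu n) * D.f2 n x)) + Complex.I * D.ρ₁ * ((D.mu n) * D.f1 n x)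
def r3 (n : ℕ) (x : ℝ) : ℂ :=
  D.ρ₂ * ((D.mu n) * ((D.mu n) * D.f4 n x)) + Complex.I * D.ρ₂ * ((D.mu n) * D.f3 n x)
def r5 (α : ℝ) (n : ℕ) (x : ℝ) : ℂ :=
  (D.ρ₁ * ((D.mu n) * ((D.mu n) * D.f6 n x)) + Complex.I * D.ρ₁ * ((D.mu n) * D.f5 n x))
    + (-α : ℂ) * D.v6 n x

/-- first second-order term -/
def s1 (n : ℕ) (x : ℝ) : ℂ :=
  -(D.ρ₁ * D.lam n ^ 2 * D.u1 n x) - D.k₁ * D.p3 n x - D.l * (D.k₁ + D.k₃) * D.p5 n x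
    + D.l ^ 2 * D.k₃ * D.u1 n x - D.r1 n x
/-- second second-order term -/
def s3 (n : ℕ) (x : ℝ) : ℂ :=
  -(D.ρ₂ * D.lam n ^ 2 * D.u3 n x) + D.k₁ * (D.p1 n x + D.u3 n x + D.l * D.u5 n x) - D.r3 n x
/-- third second-order term -/
def s5 (α : ℝ) (n : ℕ) (x : ℝ) : ℂ :=
  -(D.ρ₁ * D.lam n ^ 2 * D.u5 n x) + D.l * (D.k₁ + D.k₃) * D.p1 n x + D.l * D.k₁ * D.u3 n x
    + D.l ^ 2 * D.k₁ * D.u5 n x - D.r5 α n x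

/-- the hypotheses on one piece -/
structure Good (a b α : ℝ) : Prop where
  hab : a < b
  du1 : ∀ n, ∀ x ∈ Ioo a b, HasDerivAt (D.u1 n) (D.p1 n x) x
  du3 : ∀ n, ∀ x ∈ Ioo a b, HasDerivAt (D.u3 n) (D.p3 n x) x
  du5 : ∀ n, ∀ x ∈ Ioo a b, HasDerivAt (D.u5 n) (D.p5 n x) x
  dp1 : ∀ n, ∀ x ∈ Ioo a b, HasDerivAt (D.p1 n) ((D.k₁ : ℂ)⁻¹ * D.s1 n x) x
  dp3 : ∀ n, ∀ x ∈ Ioo a b, HasDerivAt (D.p3 n) ((D.k₂ : ℂ)⁻¹ * D.s3 n x) x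
  dp5 : ∀ n, ∀ x ∈ Ioo a b, HasDerivAt (D.p5 n) ((D.k₃ : ℂ)⁻¹ * D.s5 α n x) x
  df1 : ∀ n, ∀ x ∈ Ioo a b, HasDerivAt (D.f1 n) (D.g1 n x) x
  df3 : ∀ n, ∀ x ∈ Ioo a b, HasDerivAt (D.f3 n) (D.g3 n x) x
  df5 : ∀ n, ∀ x ∈ Ioo a b, HasDerivAt (D.f5 n) (D.g5 n x) x
  cu1 : ∀ n, Continuous (D.u1 n)
  cu3 : ∀ n, Continuous (D.u3 n)
  cu5 : ∀ n, Continuous (D.u5 n)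
  Ov2 : BrO a b D.v2
  Ov4 : BrO a b D.v4
  Ov6 : BrO a b D.v6
  Op1 : BrO a b D.p1
  Op3 : BrO a b D.p3
  Op5 : BrO a b D.p5
  of1 : Bro a b D.f1
  of2 : Bro a b D.f2
  of3 : Bro a b D.f3
  of4 : Bro a b D.f4
  of5 : Bro a b D.f5
  of6 : Bro a b D.f6
  og1 : Bro a b D.g1
  og3 : Bro a b D.g3
  og5 : Bro a b D.g5

namespace Good

variable {D} {a b α : ℝ}

lemma hle (H : D.Good a b α) : a ≤ b := H.hab.le

lemma mul_mu (H : D.Good a b α) {A : ℕ → ℝ → ℂ} (hA : BrO a b A) :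
    Bro a b (fun n x => (D.mu n : ℂ) * A n x) := hA.small H.hle D.mu_tendsto

lemma Olu1 (H : D.Good a b α) : BrO a b (fun n x => (D.lam n : ℂ) * D.u1 n x) := by
  have h := (H.mul_mu (H.mul_mu H.of1.toO).toO).toO
  refine ((H.Ov2.add H.hle h).smul H.hle (-Complex.I)).congr (fun n x => ?_)
  simp only [v2]
  linear_combination ((D.lam n : ℂ) * D.u1 n x) * Complex.I_mul_I

lemma Olu3 (H : D.Good a b α) : BrO a b (fun n x => (D.lam n : ℂ) * D.u3 n x) := by
  have h := (H.mul_mu (H.mul_mu H.of3.toO).toO).toO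
  refine ((H.Ov4.add H.hle h).smul H.hle (-Complex.I)).congr (fun n x => ?_)
  simp only [v4]
  linear_combination ((D.lam n : ℂ) * D.u3 n x) * Complex.I_mul_I

lemma Olu5 (H : D.Good a b α) : BrO a b (fun n x => (D.lam n : ℂ) * D.u5 n x) := by
  have h := (H.mul_mu (H.mul_mu H.of5.toO).toO).toO
  refine ((H.Ov6.add H.hle h).smul H.hle (-Complex.I)).congr (fun n x => ?_)
  simp only [v6]
  linear_combination ((D.lam n : ℂ) * D.u5 n x) * Complex.I_mul_I

lemma ou1 (H : D.Good a b α) : Bro a b D.u1 :=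
  (H.mul_mu H.Olu1).congr (fun n x => by linear_combination (-D.u1 n x) * D.lam_mu n)

lemma ou3 (H : D.Good a b α) : Bro a b D.u3 :=
  (H.mul_mu H.Olu3).congr (fun n x => by linear_combination (-D.u3 n x) * D.lam_mu n)

lemma ou5 (H : D.Good a b α) : Bro a b D.u5 :=
  (H.mul_mu H.Olu5).congr (fun n x => by linear_combination (-D.u5 n x) * D.lam_mu n)

lemma or1 (H : D.Good a b α) : Bro a b D.r1 :=
  ((H.mul_mu (H.mul_mu H.of2.toO).toO).smul H.hle _).add H.hle
    ((H.mul_mu H.of1.toO).smul H.hle _)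

lemma or3 (H : D.Good a b α) : Bro a b D.r3 :=
  ((H.mul_mu (H.mul_mu H.of4.toO).toO).smul H.hle _).add H.hle
    ((H.mul_mu H.of3.toO).smul H.hle _)

lemma or5 (H : D.Good a b α) (h : Bro a b (fun n x => (-α : ℂ) * D.v6 n x)) :
    Bro a b (D.r5 α) :=
  (((H.mul_mu (H.mul_mu H.of6.toO).toO).smul H.hle _).add H.hle
    ((H.mul_mu H.of5.toO).smul H.hle _)).add H.hle h

end Good

def T1 (n : ℕ) (x : ℝ) : ℂ := D.p1 n x + D.u3 n x + D.l * D.u5 n x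
def T5 (n : ℕ) (x : ℝ) : ℂ := D.p5 n x - D.l * D.u1 n x

def Bd (n : ℕ) (x : ℝ) : ℝ :=
  brIp (D.k₁ * D.T1 n x) (D.v2 n x) + brIp (D.k₂ * D.p3 n x) (D.v4 n x)
    + brIp (D.k₃ * D.T5 n x) (D.v6 n x)

def W (n : ℕ) (x : ℝ) : ℝ :=
  D.ρ₁ * brIp (D.f2 n x) (D.v2 n x) + D.ρ₂ * brIp (D.f4 n x) (D.v4 n x)
    + D.ρ₁ * brIp (D.f6 n x) (D.v6 n x)
    + D.k₁ * brIp (D.T1 n x) (D.g1 n x + D.f3 n x + D.l * D.f5 n x)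
    + D.k₂ * brIp (D.p3 n x) (D.g3 n x)
    + D.k₃ * brIp (D.T5 n x) (D.g5 n x + (-D.l) * D.f1 n x)

lemma Bd_deriv {a b α : ℝ} (H : D.Good a b α) (n : ℕ) (x : ℝ) (hx : x ∈ Ioo a b) :
    HasDerivAt (D.Bd n) (α * ‖D.v6 n x‖ ^ 2 - D.mu n ^ 2 * D.W n x) x := by
  have hk1 : (D.k₁ : ℂ) ≠ 0 := by exact_mod_cast D.hk₁.ne'
  have hk2 : (D.k₂ : ℂ) ≠ 0 := by exact_mod_cast D.hk₂.ne'
  have hk3 : (D.k₃ : ℂ) ≠ 0 := by exact_mod_cast D.hk₃.ne'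
  have hlm := D.lam_mu n
  have dv2 : HasDerivAt (D.v2 n) (Complex.I * D.lam n * D.p1 n x - (D.mu n) ^ 2 * D.g1 n x) x :=
    ((H.du1 n x hx).const_mul _).sub ((H.df1 n x hx).const_mul _)
  have dv4 : HasDerivAt (D.v4 n) (Complex.I * D.lam n * D.p3 n x - (D.mu n) ^ 2 * D.g3 n x) x :=
    ((H.du3 n x hx).const_mul _).sub ((H.df3 n x hx).const_mul _)
  have dv6 : HasDerivAt (D.v6 n) (Complex.I * D.lam n * D.p5 n x - (D.mu n) ^ 2 * D.g5 n x) x :=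
    ((H.du5 n x hx).const_mul _).sub ((H.df5 n x hx).const_mul _)
  have dT1 : HasDerivAt (fun y => D.k₁ * D.T1 n y)
      (Complex.I * D.lam n * D.ρ₁ * D.v2 n x - D.l * D.k₃ * D.T5 n x
        - D.ρ₁ * D.mu n ^ 2 * D.f2 n x) x := by
    refine ((((H.dp1 n x hx).add (H.du3 n x hx)).add
      ((H.du5 n x hx).const_mul (D.l : ℂ))).const_mul (D.k₁ : ℂ)).congr_deriv ?_
    rw [mul_add, mul_add, mul_inv_cancel_left₀ hk1]
    simp only [s1, r1, v2, T5]
    linear_combination (-(D.ρ₁ : ℂ) * D.lam n ^ 2 * D.u1 n x) * Complex.I_mul_I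
      + (Complex.I * D.ρ₁ * D.mu n * D.f1 n x) * hlm
  have dT3 : HasDerivAt (fun y => D.k₂ * D.p3 n y)
      (Complex.I * D.lam n * D.ρ₂ * D.v4 n x + D.k₁ * D.T1 n x
        - D.ρ₂ * D.mu n ^ 2 * D.f4 n x) x := by
    refine ((H.dp3 n x hx).const_mul (D.k₂ : ℂ)).congr_deriv ?_
    rw [mul_inv_cancel_left₀ hk2]
    simp only [s3, r3, v4, T1]
    linear_combination (-(D.ρ₂ : ℂ) * D.lam n ^ 2 * D.u3 n x) * Complex.I_mul_I
      + (Complex.I * D.ρ₂ * D.mu n * D.f3 n x) * hlm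
  have dT5 : HasDerivAt (fun y => D.k₃ * D.T5 n y)
      (Complex.I * D.lam n * D.ρ₁ * D.v6 n x + D.l * D.k₁ * D.T1 n x + α * D.v6 n x
        - D.ρ₁ * D.mu n ^ 2 * D.f6 n x) x := by
    refine (((H.dp5 n x hx).sub
      ((H.du1 n x hx).const_mul (D.l : ℂ))).const_mul (D.k₃ : ℂ)).congr_deriv ?_
    rw [mul_sub, mul_inv_cancel_left₀ hk3]
    simp only [s5, r5, v6, T1]
    linear_combination (-(D.ρ₁ : ℂ) * D.lam n ^ 2 * D.u5 n x) * Complex.I_mul_I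
      + (Complex.I * D.ρ₁ * D.mu n * D.f5 n x) * hlm
  have h := ((brIp_hasDerivAt dT1 dv2).add (brIp_hasDerivAt dT3 dv4)).add (brIp_hasDerivAt dT5 dv6)
  refine h.congr_deriv ?_
  have e2 : Complex.I * D.lam n * D.p1 n x - (D.mu n) ^ 2 * D.g1 n x
      = Complex.I * D.lam n * D.T1 n x
        - (D.mu n) ^ 2 * (D.g1 n x + D.f3 n x + D.l * D.f5 n x) - D.v4 n x - D.l * D.v6 n x := by
    simp only [T1, v4, v6]; ring
  have e6 : Complex.I * D.lam n * D.p5 n x - (D.mu n) ^ 2 * D.g5 n x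
      = Complex.I * D.lam n * D.T5 n x
        - (D.mu n) ^ 2 * (D.g5 n x + (-D.l) * D.f1 n x) + D.l * D.v2 n x := by
    simp only [T5, v2]; ring
  rw [e2, e6, ← brIp_self, W]
  generalize D.g1 n x + D.f3 n x + D.l * D.f5 n x = G1
  generalize D.g5 n x + (-D.l) * D.f1 n x = G5
  generalize D.v2 n x = V2
  generalize D.v4 n x = V4
  generalize D.v6 n x = V6
  generalize D.T1 n x = T1
  generalize D.T5 n x = T5
  simp only [brIp, pow_two, Complex.add_re, Complex.add_im, Complex.sub_re, Complex.sub_im,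
    Complex.mul_re, Complex.mul_im, Complex.ofReal_re, Complex.ofReal_im, Complex.I_re,
    Complex.I_im]
  ring

lemma W_T {a b α : ℝ} (H : D.Good a b α) : BrT a b D.W := by
  have h := H.hle
  have hT1 : BrO a b D.T1 := (H.Op1.add h H.ou3.toO).add h (H.ou5.toO.smul h _)
  have hT5 : BrO a b D.T5 := (H.Op5.add h (H.ou1.toO.smul h (-D.l : ℂ))).congr
    (fun n x => by simp only [T5]; ring)
  have hG1 := (H.og1.add h H.of3).add h (H.of5.smul h (D.l : ℂ))
  have hG5 := H.og5.add h (H.of1.smul h (-D.l : ℂ))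
  exact ((((((H.of2.ip h H.Ov2).smul D.ρ₁).add ((H.of4.ip h H.Ov4).smul D.ρ₂)).add
    ((H.of6.ip h H.Ov6).smul D.ρ₁)).add ((hT1.ip h hG1).smul D.k₁)).add
    ((H.Op3.ip h H.og3).smul D.k₂)).add ((hT5.ip h hG5).smul D.k₃)

lemma dissip {a b α : ℝ} (H : D.Good a b α) :
    Tendsto (fun n => D.lam n ^ 2 * (α * (∫ x in a..b, ‖D.v6 n x‖ ^ 2) - (D.Bd n b - D.Bd n a)))
      atTop (nhds 0) := by
  have hW := D.W_T H
  refine hW.2.congr (fun n => ?_)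
  have c1 := H.cu1 n
  have c3 := H.cu3 n
  have c5 := H.cu5 n
  have d1 := H.Op1.1 n
  have d3 := H.Op3.1 n
  have d5 := H.Op5.1 n
  have c2 := H.Ov2.1 n
  have c4 := H.Ov4.1 n
  have c6 := H.Ov6.1 n
  have cB : Continuous (D.Bd n) := by
    refine ((brIp_continuous ?_ c2).add (brIp_continuous ?_ c4)).add (brIp_continuous ?_ c6)
    · unfold T1; fun_prop
    · fun_prop
    · unfold T5; fun_prop
  have cW := hW.1 n
  have := br_ftc H.hle cB (F' := fun x => α * ‖D.v6 n x‖ ^ 2 - D.mu n ^ 2 * D.W n x)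
    (by fun_prop) (fun x hx => D.Bd_deriv H n x hx)
  rw [← this, intervalIntegral.integral_sub (Continuous.intervalIntegrable (by fun_prop) _ _)
    (Continuous.intervalIntegrable (by fun_prop) _ _), intervalIntegral.integral_const_mul,
    intervalIntegral.integral_const_mul]
  have hl := D.lam_ne n
  simp only [mu]
  field_simp
  ring

/-- energy density -/
def en (n : ℕ) (x : ℝ) : ℝ :=
  D.ρ₁ * D.lam n ^ 2 * ‖D.u1 n x‖ ^ 2 + D.k₁ * ‖D.p1 n x‖ ^ 2
    + D.ρ₂ * D.lam n ^ 2 * ‖D.u3 n x‖ ^ 2 + D.k₂ * ‖D.p3 n x‖ ^ 2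
    + D.ρ₁ * D.lam n ^ 2 * ‖D.u5 n x‖ ^ 2 + D.k₃ * ‖D.p5 n x‖ ^ 2

lemma en_cont {a b α : ℝ} (H : D.Good a b α) (n : ℕ) : Continuous (D.en n) := by
  have c1 := H.cu1 n
  have c3 := H.cu3 n
  have c5 := H.cu5 n
  have d1 := H.Op1.1 n
  have d3 := H.Op3.1 n
  have d5 := H.Op5.1 n
  unfold en
  fun_prop

def Z (α : ℝ) (n : ℕ) (x : ℝ) : ℝ :=
  brIp (D.l ^ 2 * D.k₃ * D.u1 n x + (-1) * D.r1 n x) (D.p1 n x)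
  + brIp (D.k₁ * D.u3 n x + D.k₁ * D.l * D.u5 n x + (-1) * D.r3 n x) (D.p3 n x)
  + brIp (D.l * D.k₁ * D.u3 n x + D.l ^ 2 * D.k₁ * D.u5 n x + (-1) * D.r5 α n x) (D.p5 n x)

lemma en_deriv {a b α : ℝ} (H : D.Good a b α) (n : ℕ) (x : ℝ) (hx : x ∈ Ioo a b) :
    HasDerivAt (D.en n) (2 * D.Z α n x) x := by
  have hk1 : D.k₁ ≠ 0 := D.hk₁.ne'
  have hk2 : D.k₂ ≠ 0 := D.hk₂.ne'
  have hk3 : D.k₃ ≠ 0 := D.hk₃.ne'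
  have h1 := (brIp_hasDerivAt (H.du1 n x hx) (H.du1 n x hx)).const_mul (D.ρ₁ * D.lam n ^ 2)
  have h2 := (brIp_hasDerivAt (H.dp1 n x hx) (H.dp1 n x hx)).const_mul (D.k₁)
  have h3 := (brIp_hasDerivAt (H.du3 n x hx) (H.du3 n x hx)).const_mul (D.ρ₂ * D.lam n ^ 2)
  have h4 := (brIp_hasDerivAt (H.dp3 n x hx) (H.dp3 n x hx)).const_mul (D.k₂)
  have h5 := (brIp_hasDerivAt (H.du5 n x hx) (H.du5 n x hx)).const_mul (D.ρ₁ * D.lam n ^ 2)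
  have h6 := (brIp_hasDerivAt (H.dp5 n x hx) (H.dp5 n x hx)).const_mul (D.k₃)
  have h := ((((h1.add h2).add h3).add h4).add h5).add h6
  have e : D.en n = fun y => D.ρ₁ * D.lam n ^ 2 * brIp (D.u1 n y) (D.u1 n y)
      + D.k₁ * brIp (D.p1 n y) (D.p1 n y)
      + D.ρ₂ * D.lam n ^ 2 * brIp (D.u3 n y) (D.u3 n y) + D.k₂ * brIp (D.p3 n y) (D.p3 n y)
      + D.ρ₁ * D.lam n ^ 2 * brIp (D.u5 n y) (D.u5 n y) + D.k₃ * brIp (D.p5 n y) (D.p5 n y) := by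
    funext y
    simp only [en, brIp_self]
  rw [e]
  refine HasDerivAt.congr_deriv (f := fun y => D.ρ₁ * D.lam n ^ 2 * brIp (D.u1 n y) (D.u1 n y)
      + D.k₁ * brIp (D.p1 n y) (D.p1 n y)
      + D.ρ₂ * D.lam n ^ 2 * brIp (D.u3 n y) (D.u3 n y) + D.k₂ * brIp (D.p3 n y) (D.p3 n y)
      + D.ρ₁ * D.lam n ^ 2 * brIp (D.u5 n y) (D.u5 n y) + D.k₃ * brIp (D.p5 n y) (D.p5 n y)) h ?_
  have c : ∀ (k : ℝ) (z w : ℂ), k ≠ 0 → k * (brIp ((k : ℂ)⁻¹ * z) w + brIp w ((k : ℂ)⁻¹ * z))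
      = 2 * brIp z w := by
    intro k z w hk
    rw [← Complex.ofReal_inv]
    simp only [brIp, Complex.mul_re, Complex.mul_im, Complex.ofReal_re, Complex.ofReal_im]
    field_simp
    ring
  rw [c _ _ _ hk1, c _ _ _ hk2, c _ _ _ hk3]
  simp only [Z, s1, s3, s5]
  generalize D.r1 n x = R1
  generalize D.r3 n x = R3
  generalize D.r5 α n x = R5
  simp only [brIp, pow_two, Complex.add_re, Complex.add_im, Complex.sub_re, Complex.sub_im,
    Complex.mul_re, Complex.mul_im, Complex.ofReal_re, Complex.ofReal_im, Complex.neg_re,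
    Complex.neg_im, Complex.one_re, Complex.one_im]
  ring

lemma mult {a b α : ℝ} (H : D.Good a b α) (h5 : Bro a b (D.r5 α)) {h h' : ℝ → ℝ}
    (hc : Continuous h) (hc' : Continuous h') (hd : ∀ x, HasDerivAt h (h' x) x) :
    Tendsto (fun n => (∫ x in a..b, h' x * D.en n x) - (h b * D.en n b - h a * D.en n a))
      atTop (nhds 0) := by
  have hab := H.hle
  have hcc : Continuous (fun x => ((2 * h x : ℝ) : ℂ)) := by fun_prop
  have t1 := ((((H.ou1.smul hab (D.l ^ 2 * D.k₃ : ℂ)).add hab (H.or1.smul hab (-1))).mulc hab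
    hcc).ip hab H.Op1)
  have t3 := (((((H.ou3.smul hab (D.k₁ : ℂ)).add hab (H.ou5.smul hab (D.k₁ * D.l : ℂ))).add hab
    (H.or3.smul hab (-1))).mulc hab hcc).ip hab H.Op3)
  have t5 := (((((H.ou3.smul hab (D.l * D.k₁ : ℂ)).add hab
    (H.ou5.smul hab (D.l ^ 2 * D.k₁ : ℂ))).add hab
    (h5.smul hab (-1))).mulc hab hcc).ip hab H.Op5)
  have hZ : BrT a b (fun n x => h x * (2 * D.Z α n x)) := by
    refine ((t1.add t3).add t5).congr (fun n x => ?_)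
    simp only [Z, brIp, Complex.re_ofReal_mul, Complex.im_ofReal_mul]
    ring
  have hZ' := hZ.2.neg
  rw [neg_zero] at hZ'
  refine hZ'.congr (fun n => ?_)
  have ce := D.en_cont H n
  have cz := hZ.1 n
  have := br_ftc hab (F := fun x => h x * D.en n x)
    (F' := fun x => h' x * D.en n x + h x * (2 * D.Z α n x))
    (by fun_prop) ((hc'.mul ce).add cz) (fun x hx => (hd x).mul (D.en_deriv H n x hx))
  have h2 : ∫ x in a..b, (h' x * D.en n x + h x * (2 * D.Z α n x)) =
      (∫ x in a..b, h' x * D.en n x) + ∫ x in a..b, h x * (2 * D.Z α n x) :=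
    intervalIntegral.integral_add ((hc'.mul ce).intervalIntegrable _ _)
      (cz.intervalIntegrable _ _)
  rw [← this, h2]
  ring

def q (a b x : ℝ) : ℝ := (x - a) * (b - x)
def dq (a b x : ℝ) : ℝ := a + b - 2 * x

lemma q_cont (a b : ℝ) : Continuous (q a b) := by unfold q; fun_prop
lemma dq_cont (a b : ℝ) : Continuous (dq a b) := by unfold dq; fun_prop

lemma q_deriv (a b x : ℝ) : HasDerivAt (q a b) (dq a b x) x := by
  have := ((hasDerivAt_id x).sub_const a).mul ((hasDerivAt_id x).const_sub b)
  refine this.congr_deriv ?_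
  simp only [dq, id]; ring

def Qf (a b : ℝ) (A A' B B' : ℝ → ℂ) (x : ℝ) : ℝ :=
  2 * q a b x * dq a b x * brIp (A x) (B x)
    + q a b x ^ 2 * (brIp (A' x) (B x) + brIp (A x) (B' x))

lemma Qf_cont (a b : ℝ) {A A' B B' : ℝ → ℂ} (hA : Continuous A) (hA' : Continuous A')
    (hB : Continuous B) (hB' : Continuous B') : Continuous (Qf a b A A' B B') := by
  have h1 := q_cont a b
  have h2 := dq_cont a b
  have h3 := brIp_continuous hA hB
  have h4 := brIp_continuous hA' hB
  have h5 := brIp_continuous hA hB'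
  unfold Qf
  fun_prop

lemma Qf_int {a b : ℝ} (hab : a ≤ b) {A A' B B' : ℝ → ℂ} (hA : Continuous A)
    (hA' : Continuous A') (hB : Continuous B) (hB' : Continuous B')
    (dA : ∀ x ∈ Ioo a b, HasDerivAt A (A' x) x) (dB : ∀ x ∈ Ioo a b, HasDerivAt B (B' x) x) :
    ∫ x in a..b, Qf a b A A' B B' x = 0 := by
  have h := br_ftc hab (F := fun x => q a b x ^ 2 * brIp (A x) (B x))
    (((q_cont a b).pow 2).mul (brIp_continuous hA hB)) (Qf_cont a b hA hA' hB hB') (by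
      intro x hx
      refine (((q_deriv a b x).pow 2).mul (brIp_hasDerivAt (dA x hx) (dB x hx))).congr_deriv ?_
      simp only [Qf, Pi.pow_apply]; push_cast; ring)
  rw [h]
  simp [q]

def d1 (n : ℕ) (x : ℝ) : ℂ :=
  (-D.k₁ : ℂ) * D.p3 n x + ((-(D.l * (D.k₁ + D.k₃)) : ℂ) * D.p5 n x
    + (D.l ^ 2 * D.k₃ : ℂ) * D.u1 n x + (-1 : ℂ) * D.r1 n x)
def d3 (n : ℕ) (x : ℝ) : ℂ :=
  (D.k₁ : ℂ) * (D.p1 n x + D.u3 n x + (D.l : ℂ) * D.u5 n x) + (-1 : ℂ) * D.r3 n x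
def d5 (α : ℝ) (n : ℕ) (x : ℝ) : ℂ :=
  (-D.ρ₁ : ℂ) * ((D.lam n : ℂ) * ((D.lam n : ℂ) * D.u5 n x)) + (D.l * D.k₁ : ℂ) * D.u3 n x
    + (D.l ^ 2 * D.k₁ : ℂ) * D.u5 n x + (-1 : ℂ) * D.r5 α n x

lemma s1_eq (n : ℕ) (x : ℝ) :
    D.s1 n x = ((-(D.ρ₁ * D.lam n ^ 2) : ℝ) : ℂ) * D.u1 n x + D.d1 n x := by
  simp only [s1, d1]; push_cast; ring
lemma s3_eq (n : ℕ) (x : ℝ) :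
    D.s3 n x = ((-(D.ρ₂ * D.lam n ^ 2) : ℝ) : ℂ) * D.u3 n x + D.d3 n x := by
  simp only [s3, d3]; push_cast; ring
lemma s5_eq (α : ℝ) (n : ℕ) (x : ℝ) :
    D.s5 α n x = ((D.l * (D.k₁ + D.k₃) : ℝ) : ℂ) * D.p1 n x + D.d5 α n x := by
  simp only [s5, d5]; push_cast; ring

lemma brIp_add_left (z w y : ℂ) : brIp (z + w) y = brIp z y + brIp w y := by
  simp only [brIp, Complex.add_re, Complex.add_im]; ring
lemma brIp_add_right (z w y : ℂ) : brIp y (z + w) = brIp y z + brIp y w := by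
  simp only [brIp, Complex.add_re, Complex.add_im]; ring
lemma brIp_smul_left (c : ℝ) (z w : ℂ) : brIp ((c : ℂ) * z) w = c * brIp z w := by
  simp only [brIp, Complex.re_ofReal_mul, Complex.im_ofReal_mul]; ring
lemma brIp_smul_right (c : ℝ) (z w : ℂ) : brIp z ((c : ℂ) * w) = c * brIp z w := by
  simp only [brIp, Complex.re_ofReal_mul, Complex.im_ofReal_mul]; ring

lemma local_en {a b α : ℝ} (H : D.Good a b α) (h5 : Bro a b (D.r5 α))
    (hw : Bro a b (fun n x => (D.lam n : ℂ) * ((D.lam n : ℂ) * D.u5 n x)))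
    (heq : D.k₁ * D.ρ₂ = D.k₂ * D.ρ₁) :
    Tendsto (fun n => ∫ x in a..b, q a b x ^ 2 * D.en n x) atTop (nhds 0) := by
  have hab := H.hle
  have hk1 : (D.k₁ : ℂ) ≠ 0 := by exact_mod_cast D.hk₁.ne'
  have hk2 : (D.k₂ : ℂ) ≠ 0 := by exact_mod_cast D.hk₂.ne'
  have hk3 : (D.k₃ : ℂ) ≠ 0 := by exact_mod_cast D.hk₃.ne'
  have pk1 := D.hk₁
  have pk2 := D.hk₂
  have pk3 := D.hk₃
  have pr1 := D.hρ₁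
  have pr2 := D.hρ₂
  have pl := D.hl
  have cq : Continuous (fun x => ((q a b x : ℝ) : ℂ)) :=
    Complex.continuous_ofReal.comp (q_cont a b)
  have cdq : Continuous (fun x => ((dq a b x : ℝ) : ℂ)) :=
    Complex.continuous_ofReal.comp (dq_cont a b)
  have od5 : Bro a b (D.d5 α) :=
    (((hw.smul hab _).add hab (H.ou3.smul hab _)).add hab (H.ou5.smul hab _)).add hab
      (h5.smul hab _)
  have Od1' := ((H.Op5.smul hab (-(D.l * (D.k₁ + D.k₃)) : ℂ)).add hab
      (H.ou1.toO.smul hab (D.l ^ 2 * D.k₃ : ℂ))).add hab (H.or1.toO.smul hab (-1))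
  have Od1 : BrO a b D.d1 := (H.Op3.smul hab _).add hab Od1'
  have Od3 : BrO a b D.d3 :=
    (((H.Op1.add hab H.ou3.toO).add hab (H.ou5.toO.smul hab _)).smul hab _).add hab
      (H.or3.toO.smul hab _)
  have Os5 : BrO a b (D.s5 α) := ((H.Op1.smul hab _).add hab od5.toO).congr (D.s5_eq α)
  have Oms1 : BrO a b (fun n x => (D.mu n : ℂ) * D.s1 n x) := by
    refine ((H.Olu1.smul hab (-D.ρ₁ : ℂ)).add hab (H.mul_mu Od1).toO).congr (fun n x => ?_)
    rw [s1_eq]; push_cast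
    linear_combination (-(D.ρ₁ : ℂ) * D.lam n * D.u1 n x) * D.lam_mu n
  have cs1 : ∀ n, Continuous (D.s1 n) := fun n => by
    have h1 := H.cu1 n
    have h2 := Od1.1 n
    rw [funext (D.s1_eq n)]; fun_prop
  have cs3 : ∀ n, Continuous (D.s3 n) := fun n => by
    have h1 := H.cu3 n
    have h2 := Od3.1 n
    rw [funext (D.s3_eq n)]; fun_prop
  have cs5 := Os5.1
  have cP1 : ∀ n, Continuous (fun x => (D.k₁ : ℂ) * D.p1 n x) :=
    fun n => continuous_const.mul (H.Op1.1 n)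
  have cP3 : ∀ n, Continuous (fun x => (D.k₂ : ℂ) * D.p3 n x) :=
    fun n => continuous_const.mul (H.Op3.1 n)
  have cP5 : ∀ n, Continuous (fun x => (D.k₃ : ℂ) * D.p5 n x) :=
    fun n => continuous_const.mul (H.Op5.1 n)
  have dP1 : ∀ n, ∀ x ∈ Ioo a b, HasDerivAt (fun x => (D.k₁ : ℂ) * D.p1 n x) (D.s1 n x) x :=
    fun n x hx => ((H.dp1 n x hx).const_mul _).congr_deriv (mul_inv_cancel_left₀ hk1 _)
  have dP3 : ∀ n, ∀ x ∈ Ioo a b, HasDerivAt (fun x => (D.k₂ : ℂ) * D.p3 n x) (D.s3 n x) x :=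
    fun n x hx => ((H.dp3 n x hx).const_mul _).congr_deriv (mul_inv_cancel_left₀ hk2 _)
  have dP5 : ∀ n, ∀ x ∈ Ioo a b, HasDerivAt (fun x => (D.k₃ : ℂ) * D.p5 n x) (D.s5 α n x) x :=
    fun n x hx => ((H.dp5 n x hx).const_mul _).congr_deriv (mul_inv_cancel_left₀ hk3 _)
  have hlm : ∀ n, D.lam n * D.mu n = 1 := fun n => mul_inv_cancel₀ (D.lam_ne n)
  -- step 2
  have st2 : Bro a b (fun n x => ((q a b x : ℝ) : ℂ) * ((D.lam n : ℂ) * D.p5 n x)) := by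
    have z1 := ((((H.Op5.mulc hab cq).mulc hab cdq).ip hab hw).smul (-2 * D.k₃))
    have z2 := ((((Os5.mulc hab cq).mulc hab cq).ip hab hw).smul (-1))
    refine Bro.of_key (K := D.k₃) pk3 (fun n => ?_)
      (D := fun n x => D.lam n ^ 2 * Qf a b (fun x => (D.k₃ : ℂ) * D.p5 n x) (D.s5 α n)
        (D.u5 n) (D.p5 n) x) (fun n => ?_) (fun n => ?_) (z1.add z2) (fun n x => ?_)
    · exact cq.mul (continuous_const.mul (H.Op5.1 n))
    · exact continuous_const.mul (Qf_cont a b (cP5 n) (cs5 n) (H.cu5 n) (H.Op5.1 n))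
    · rw [intervalIntegral.integral_const_mul, Qf_int hab (cP5 n) (cs5 n) (H.cu5 n) (H.Op5.1 n)
        (dP5 n) (H.du5 n), mul_zero]
    · rw [← brIp_self]
      simp only [Qf, brIp_smul_left, brIp_smul_right]
      ring
  have oqp5 : Bro a b (fun n x => ((q a b x : ℝ) : ℂ) * D.p5 n x) :=
    (H.mul_mu st2.toO).congr (fun n x => by
      linear_combination (-((q a b x : ℝ) : ℂ) * D.p5 n x) * D.lam_mu n)
  -- step 3
  have st3 : Bro a b (fun n x => ((q a b x : ℝ) : ℂ) * D.p1 n x) := by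
    have z1 := (((oqp5.mulc hab cdq).ip hab H.Op1).smul (-2 * D.k₁ * D.k₃))
    have z2 := (((od5.mulc hab cq).ip hab (H.Op1.mulc hab cq)).smul (-D.k₁))
    have z3 := ((st2.ip hab (Oms1.mulc hab cq)).smul (-D.k₃))
    refine Bro.of_key (K := D.l * (D.k₁ + D.k₃) * D.k₁) (by positivity) (fun n => ?_)
      (D := fun n x => Qf a b (fun x => (D.k₃ : ℂ) * D.p5 n x) (D.s5 α n)
        (fun x => (D.k₁ : ℂ) * D.p1 n x) (D.s1 n) x) (fun n => ?_) (fun n => ?_)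
        ((z1.add z2).add z3) (fun n x => ?_)
    · exact cq.mul (H.Op1.1 n)
    · exact (Qf_cont a b (cP5 n) (cs5 n) (cP1 n) (cs1 n))
    · exact Qf_int hab (cP5 n) (cs5 n) (cP1 n) (cs1 n) (dP5 n) (dP1 n)
    · rw [← brIp_self]
      simp only [Qf, brIp_smul_left, brIp_smul_right, s5_eq, brIp_add_left]
      linear_combination (D.k₃ * q a b x ^ 2 * brIp (D.p5 n x) (D.s1 n x)) * hlm n
  -- step 4
  have st4 : Bro a b (fun n x => ((q a b x : ℝ) : ℂ) * ((D.lam n : ℂ) * D.u1 n x)) := by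
    have z1 := ((((H.Op1.mulc hab cq).mulc hab cdq).ip hab H.ou1).smul (2 * D.k₁))
    have z2 := ((((Od1.mulc hab cq).mulc hab cq).ip hab H.ou1).smul 1)
    have z3 := ((st3.ip hab st3.toO).smul D.k₁)
    refine Bro.of_key (K := D.ρ₁) pr1 (fun n => ?_)
      (D := fun n x => (-1) * Qf a b (fun x => (D.k₁ : ℂ) * D.p1 n x) (D.s1 n)
        (D.u1 n) (D.p1 n) x) (fun n => ?_) (fun n => ?_)
        ((z1.add z2).add z3) (fun n x => ?_)
    · exact cq.mul (continuous_const.mul (H.cu1 n))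
    · exact continuous_const.mul (Qf_cont a b (cP1 n) (cs1 n) (H.cu1 n) (H.Op1.1 n))
    · rw [intervalIntegral.integral_const_mul, Qf_int hab (cP1 n) (cs1 n) (H.cu1 n) (H.Op1.1 n)
        (dP1 n) (H.du1 n), mul_zero]
    · rw [← brIp_self]
      simp only [Qf, brIp_smul_left, brIp_smul_right, s1_eq, brIp_add_left]
      ring
  -- step 5
  have og : Bro a b (fun n x => ((q a b x : ℝ) : ℂ) *
      (((D.k₁ : ℝ) : ℂ) * D.p3 n x + D.d1 n x)) := by
    refine (((oqp5.smul hab (-(D.l * (D.k₁ + D.k₃)) : ℂ)).add hab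
      ((H.ou1.mulc hab cq).smul hab (D.l ^ 2 * D.k₃ : ℂ))).add hab
      ((H.or1.mulc hab cq).smul hab (-1))).congr (fun n x => ?_)
    simp only [d1]; ring
  have st5 : Bro a b (fun n x => ((q a b x : ℝ) : ℂ) * D.p3 n x) := by
    have z1 := (((st4.mulc hab cdq).ip hab H.Olu3).smul (2 * D.k₂ * D.ρ₁))
    have z2 := (((st3.mulc hab cdq).ip hab H.Op3).smul (2 * D.k₁ * D.k₂))
    have z3 := ((st3.ip hab (Od3.mulc hab cq)).smul D.k₁)
    have z4 := ((og.ip hab (H.Op3.mulc hab cq)).smul D.k₂)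
    refine Bro.of_key (K := D.k₁ * D.k₂) (by positivity) (fun n => ?_)
      (D := fun n x => (-(D.k₂ * D.ρ₁ * D.lam n ^ 2)) *
          Qf a b (D.u1 n) (D.p1 n) (D.u3 n) (D.p3 n) x
        + (-1) * Qf a b (fun x => (D.k₁ : ℂ) * D.p1 n x) (D.s1 n)
          (fun x => (D.k₂ : ℂ) * D.p3 n x) (D.s3 n) x) (fun n => ?_) (fun n => ?_)
        (((z1.add z2).add z3).add z4) (fun n x => ?_)
    · exact cq.mul (H.Op3.1 n)
    · exact (continuous_const.mul (Qf_cont a b (H.cu1 n) (H.Op1.1 n) (H.cu3 n) (H.Op3.1 n))).add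
        (continuous_const.mul (Qf_cont a b (cP1 n) (cs1 n) (cP3 n) (cs3 n)))
    · rw [intervalIntegral.integral_add, intervalIntegral.integral_const_mul,
        intervalIntegral.integral_const_mul,
        Qf_int hab (H.cu1 n) (H.Op1.1 n) (H.cu3 n) (H.Op3.1 n) (H.du1 n) (H.du3 n),
        Qf_int hab (cP1 n) (cs1 n) (cP3 n) (cs3 n) (dP1 n) (dP3 n)]
      · simp
      · exact (continuous_const.mul
          (Qf_cont a b (H.cu1 n) (H.Op1.1 n) (H.cu3 n) (H.Op3.1 n))).intervalIntegrable _ _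
      · exact (continuous_const.mul
          (Qf_cont a b (cP1 n) (cs1 n) (cP3 n) (cs3 n))).intervalIntegrable _ _
    · rw [← brIp_self]
      simp only [Qf, brIp_smul_left, brIp_smul_right, s1_eq, s3_eq, brIp_add_left,
        brIp_add_right]
      linear_combination
        (-D.lam n ^ 2 * q a b x ^ 2 * brIp (D.p1 n x) (D.u3 n x)) * heq
  -- step 6
  have st6 : Bro a b (fun n x => ((q a b x : ℝ) : ℂ) * ((D.lam n : ℂ) * D.u3 n x)) := by
    have z1 := ((((H.Op3.mulc hab cq).mulc hab cdq).ip hab H.ou3).smul (2 * D.k₂))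
    have z2 := ((((Od3.mulc hab cq).mulc hab cq).ip hab H.ou3).smul 1)
    have z3 := ((st5.ip hab st5.toO).smul D.k₂)
    refine Bro.of_key (K := D.ρ₂) pr2 (fun n => ?_)
      (D := fun n x => (-1) * Qf a b (fun x => (D.k₂ : ℂ) * D.p3 n x) (D.s3 n)
        (D.u3 n) (D.p3 n) x) (fun n => ?_) (fun n => ?_)
        ((z1.add z2).add z3) (fun n x => ?_)
    · exact cq.mul (continuous_const.mul (H.cu3 n))
    · exact continuous_const.mul (Qf_cont a b (cP3 n) (cs3 n) (H.cu3 n) (H.Op3.1 n))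
    · rw [intervalIntegral.integral_const_mul, Qf_int hab (cP3 n) (cs3 n) (H.cu3 n) (H.Op3.1 n)
        (dP3 n) (H.du3 n), mul_zero]
    · rw [← brIp_self]
      simp only [Qf, brIp_smul_left, brIp_smul_right, s3_eq, brIp_add_left]
      ring
  have st7 : Bro a b (fun n x => ((q a b x : ℝ) : ℂ) * ((D.lam n : ℂ) * D.u5 n x)) := by
    refine ((H.mul_mu hw.toO).mulc hab cq).congr (fun n x => ?_)
    linear_combination (-((q a b x : ℝ) : ℂ) * D.lam n * D.u5 n x) * D.lam_mu n
  have fin := ((((((st4.ip hab st4.toO).smul D.ρ₁).add ((st3.ip hab st3.toO).smul D.k₁)).add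
    ((st6.ip hab st6.toO).smul D.ρ₂)).add ((st5.ip hab st5.toO).smul D.k₂)).add
    ((st7.ip hab st7.toO).smul D.ρ₁)).add ((oqp5.ip hab oqp5.toO).smul D.k₃)
  refine (fin.congr (B := fun n x => q a b x ^ 2 * D.en n x) (fun n x => ?_)).2
  simp only [en, ← brIp_self, brIp_smul_left, brIp_smul_right]
  ring

/-- total energy tends to zero -/
lemma total {β L a₀ : ℝ} (ha : 0 < a₀) (H : D.Good 0 β a₀) (H' : D.Good β L 0)
    (heq : D.k₁ * D.ρ₂ = D.k₂ * D.ρ₁) (hB0 : ∀ n, D.Bd n 0 = 0) (hBL : ∀ n, D.Bd n L = 0) :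
    Tendsto (fun n => ∫ x in (0:ℝ)..L, D.en n x) atTop (nhds 0) := by
  have hab := H.hle
  have hβ := H.hab
  have hβL := H'.hab
  have hv : Bro 0 β (fun n x => (D.lam n : ℂ) * D.v6 n x) := by
    refine ⟨fun n => continuous_const.mul (H.Ov6.1 n), ?_⟩
    have h := ((D.dissip H).add (D.dissip H')).const_mul a₀⁻¹
    rw [add_zero, mul_zero] at h
    refine h.congr (fun n => ?_)
    have : ∫ x in (0:ℝ)..β, ‖(D.lam n : ℂ) * D.v6 n x‖ ^ 2 =
        D.lam n ^ 2 * ∫ x in (0:ℝ)..β, ‖D.v6 n x‖ ^ 2 := by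
      rw [← intervalIntegral.integral_const_mul]
      refine intervalIntegral.integral_congr (fun x _ => ?_)
      simp [mul_pow]
    rw [this, hB0, hBL]
    field_simp
    ring
  have hw : Bro 0 β (fun n x => (D.lam n : ℂ) * ((D.lam n : ℂ) * D.u5 n x)) := by
    refine ((hv.add hab (H.mul_mu H.of5.toO)).smul hab (-Complex.I)).congr (fun n x => ?_)
    simp only [v6]
    linear_combination ((D.lam n : ℂ) ^ 2 * D.u5 n x) * Complex.I_mul_I
      - Complex.I * D.mu n * D.f5 n x * D.lam_mu n
  have ov6 : Bro 0 β D.v6 := (H.mul_mu hv.toO).congr (fun n x => by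
    linear_combination (-D.v6 n x) * D.lam_mu n)
  have h5 := H.or5 (ov6.smul hab (-a₀ : ℂ))
  have h5' : Bro β L (D.r5 0) := H'.or5 (by
    refine (H'.of5.smul H'.hle 0).congr (fun n x => ?_)
    simp)
  have hloc := D.local_en H h5 hw heq
  have cq2 : Continuous (fun x => q 0 β x ^ 2) := (q_cont 0 β).pow 2
  set h : ℝ → ℝ := fun x => ∫ t in (0:ℝ)..x, q 0 β t ^ 2 with hh
  have hd : ∀ x, HasDerivAt h (q 0 β x ^ 2) x := fun x =>
    intervalIntegral.integral_hasDerivAt_right (cq2.intervalIntegrable _ _)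
      (cq2.stronglyMeasurableAtFilter _ _) cq2.continuousAt
  have hc : Continuous h := continuous_iff_continuousAt.2 fun x => (hd x).continuousAt
  have h0 : h 0 = 0 := by simp [hh]
  have hpos : 0 < h β := by
    refine intervalIntegral.intervalIntegral_pos_of_pos_on (cq2.intervalIntegrable _ _) ?_ hβ
    intro x hx
    have : 0 < q 0 β x := by
      unfold q
      exact mul_pos (by linarith [hx.1]) (by linarith [hx.2])
    positivity
  have m1 := D.mult H h5 hc cq2 hd
  have eb : Tendsto (fun n => D.en n β) atTop (nhds 0) := by
    have h := (hloc.sub m1).const_mul (h β)⁻¹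
    rw [sub_zero, mul_zero] at h
    refine h.congr (fun n => ?_)
    rw [h0]
    field_simp
    ring
  have m2 := D.mult H h5 continuous_id continuous_const (fun x => hasDerivAt_id x)
  have m3 := D.mult H' h5' (h := fun x => x - L) (by fun_prop) continuous_const
    (fun x => (hasDerivAt_id x).sub_const L)
  have := (m2.add m3).add (eb.const_mul L)
  rw [add_zero, mul_zero, add_zero] at this
  refine this.congr (fun n => ?_)
  have ce := D.en_cont H n
  rw [← intervalIntegral.integral_add_adjacent_intervals (ce.intervalIntegrable 0 β)
    (ce.intervalIntegrable β L)]
  simp only [one_mul, id]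
  ring

end BrD

/-! ### Bridge from the given setting to the cleaned-up data -/

def brE (L : ℝ) (f : ℝ → ℂ) (x : ℝ) : ℂ := f (max 0 (min x L))

lemma brE_eq {L : ℝ} (f : ℝ → ℂ) {x : ℝ} (hx : x ∈ Icc 0 L) : brE L f x = f x := by
  unfold brE; rw [min_eq_left hx.2, max_eq_right hx.1]

lemma brE_cont {L : ℝ} (hL : 0 ≤ L) {f : ℝ → ℂ} (hf : ContinuousOn f (Icc 0 L)) :
    Continuous (brE L f) := by
  refine hf.comp_continuous (by fun_prop) (fun x => ⟨le_max_left _ _, ?_⟩)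
  exact max_le hL (min_le_right _ _)

lemma brE_ev {L : ℝ} (f : ℝ → ℂ) {x : ℝ} (hx : x ∈ Ioo 0 L) : brE L f =ᶠ[nhds x] f := by
  filter_upwards [Ioo_mem_nhds hx.1 hx.2] with y hy
  exact brE_eq f ⟨hy.1.le, hy.2.le⟩

lemma brE_dcont {L : ℝ} (hL : 0 < L) {f : ℝ → ℂ} (hf : ContDiffOn ℝ 1 f (Icc 0 L)) :
    Continuous (brE L (derivWithin f (Icc 0 L))) :=
  brE_cont hL.le (hf.continuousOn_derivWithin (uniqueDiffOn_Icc hL) le_rfl)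

lemma brE_deq {L : ℝ} (f : ℝ → ℂ) {x : ℝ} (hx : x ∈ Ioo 0 L) :
    brE L (derivWithin f (Icc 0 L)) x = deriv f x := by
  rw [brE_eq _ ⟨hx.1.le, hx.2.le⟩, derivWithin_of_mem_nhds (Icc_mem_nhds hx.1 hx.2)]

lemma brE_diff {a b : ℝ} {f : ℝ → ℂ} (hf : ContDiffOn ℝ 1 f (Icc a b)) {x : ℝ}
    (hx : x ∈ Ioo a b) : DifferentiableAt ℝ f x :=
  (hf.differentiableOn one_ne_zero).differentiableAt (Icc_mem_nhds hx.1 hx.2)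

lemma brE_deriv {L : ℝ} {f : ℝ → ℂ} (hf : ContDiffOn ℝ 1 f (Icc 0 L)) {x : ℝ}
    (hx : x ∈ Ioo 0 L) :
    HasDerivAt (brE L f) (brE L (derivWithin f (Icc 0 L)) x) x := by
  rw [brE_deq f hx]
  exact (brE_diff hf hx).hasDerivAt.congr_of_eventuallyEq (brE_ev f hx)

lemma brE_diff2 {a b : ℝ} {f : ℝ → ℂ} (hf : ContDiffOn ℝ 2 f (Icc a b)) {x : ℝ}
    (hx : x ∈ Ioo a b) : DifferentiableAt ℝ (deriv f) x := by
  have h1 : ContDiffOn ℝ 2 f (Ioo a b) := hf.mono Ioo_subset_Icc_self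
  have h2 : ContDiffOn ℝ 1 (deriv f) (Ioo a b) := h1.deriv_of_isOpen isOpen_Ioo (by norm_num)
  exact (h2.differentiableOn one_ne_zero).differentiableAt (Ioo_mem_nhds hx.1 hx.2)

lemma brE_deriv2 {a b L : ℝ} {f : ℝ → ℂ} (ha : 0 ≤ a) (hb : b ≤ L)
    (hf : ContDiffOn ℝ 2 f (Icc a b)) {x : ℝ} (hx : x ∈ Ioo a b) :
    HasDerivAt (brE L (derivWithin f (Icc 0 L))) (deriv (deriv f) x) x := by
  refine (brE_diff2 hf hx).hasDerivAt.congr_of_eventuallyEq ?_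
  have hx' : x ∈ Ioo 0 L := ⟨ha.trans_lt hx.1, hx.2.trans_le hb⟩
  filter_upwards [Ioo_mem_nhds hx'.1 hx'.2] with y hy
  exact brE_deq f hy

lemma br_congr {β L c d : ℝ} (hc : 0 ≤ c) (hcd : c ≤ d) (hd : d ≤ L) {f g : ℝ → ℝ}
    (h : ∀ x ∈ Ioo (0 : ℝ) β ∪ Ioo β L, f x = g x) :
    ∫ x in c..d, f x = ∫ x in c..d, g x := by
  apply intervalIntegral.integral_congr_ae
  have hfin : ({β, L} : Set ℝ).Countable := (Set.toFinite _).countable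
  filter_upwards [hfin.ae_notMem volume] with x hx hx2
  rw [uIoc_of_le hcd] at hx2
  simp only [mem_insert_iff, mem_singleton_iff, not_or] at hx
  apply h
  rcases lt_or_gt_of_ne hx.1 with h1 | h1
  · exact Or.inl ⟨hc.trans_lt hx2.1, h1⟩
  · exact Or.inr ⟨h1, lt_of_le_of_ne (hx2.2.trans hd) hx.2⟩

lemma br_le_of {a b c : ℝ} (hab : a ≤ b) (hc : 0 < c) {A : ℝ → ℂ} {E : ℝ → ℝ}
    (hA : Continuous A) (hE : Continuous E) (h : ∀ x, c * ‖A x‖ ^ 2 ≤ E x) :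
    ∫ x in a..b, ‖A x‖ ^ 2 ≤ c⁻¹ * ∫ x in a..b, E x := by
  rw [← intervalIntegral.integral_const_mul]
  apply intervalIntegral.integral_mono_on hab
  · exact Continuous.intervalIntegrable (by fun_prop) _ _
  · exact Continuous.intervalIntegrable (by fun_prop) _ _
  · intro x _
    rw [inv_mul_eq_div, le_div_iff₀ hc]
    linarith [h x]

lemma BrO.of_le {a b c : ℝ} (hab : a ≤ b) (hc : 0 < c) {A : ℕ → ℝ → ℂ} {E : ℕ → ℝ → ℝ}
    (hA : ∀ n, Continuous (A n)) (hE : ∀ n, Continuous (E n))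
    (h : ∀ n x, c * ‖A n x‖ ^ 2 ≤ E n x) {C : ℝ} (hC : ∀ n, ∫ x in a..b, E n x = C) :
    BrO a b A :=
  ⟨hA, c⁻¹ * C, fun n => by rw [← hC n]; exact br_le_of hab hc (hA n) (hE n) (h n)⟩

lemma Bro.of_le {a b c : ℝ} (hab : a ≤ b) (hc : 0 < c) {A : ℕ → ℝ → ℂ} {E : ℕ → ℝ → ℝ}
    (hA : ∀ n, Continuous (A n)) (hE : ∀ n, Continuous (E n))
    (h : ∀ n x, c * ‖A n x‖ ^ 2 ≤ E n x)
    (hC : Tendsto (fun n => ∫ x in a..b, E n x) atTop (nhds 0)) :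
    Bro a b A :=
  ⟨hA, squeeze_zero (fun n => br_nn hab _) (fun n => br_le_of hab hc (hA n) (hE n) (h n))
    (by simpa using hC.const_mul c⁻¹)⟩

lemma br_six1 {a b c d e f : ℝ} (ha : 0 ≤ a) (hb : 0 ≤ b) (hc : 0 ≤ c) (hd : 0 ≤ d)
    (he : 0 ≤ e) (hf : 0 ≤ f) : a ≤ a + b + c + d + e + f := by linarith

lemma br_six2 {a b c d e f : ℝ} (ha : 0 ≤ a) (hb : 0 ≤ b) (hc : 0 ≤ c) (hd : 0 ≤ d)
    (he : 0 ≤ e) (hf : 0 ≤ f) : b ≤ a + b + c + d + e + f := by linarith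

lemma br_six3 {a b c d e f : ℝ} (ha : 0 ≤ a) (hb : 0 ≤ b) (hc : 0 ≤ c) (hd : 0 ≤ d)
    (he : 0 ≤ e) (hf : 0 ≤ f) : c ≤ a + b + c + d + e + f := by linarith

lemma br_six4 {a b c d e f : ℝ} (ha : 0 ≤ a) (hb : 0 ≤ b) (hc : 0 ≤ c) (hd : 0 ≤ d)
    (he : 0 ≤ e) (hf : 0 ≤ f) : d ≤ a + b + c + d + e + f := by linarith

lemma br_six5 {a b c d e f : ℝ} (ha : 0 ≤ a) (hb : 0 ≤ b) (hc : 0 ≤ c) (hd : 0 ≤ d)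
    (he : 0 ≤ e) (hf : 0 ≤ f) : e ≤ a + b + c + d + e + f := by linarith

lemma br_six6 {a b c d e f : ℝ} (ha : 0 ≤ a) (hb : 0 ≤ b) (hc : 0 ≤ c) (hd : 0 ≤ d)
    (he : 0 ≤ e) (hf : 0 ≤ f) : f ≤ a + b + c + d + e + f := by linarith

section Bridge

variable {ρ₁ ρ₂ k₁ k₂ k₃ l L β a₀ : ℝ}

/-- cleaned-up data from the setting -/
def brMk (hrho1 : 0 < ρ₁) (hrho2 : 0 < ρ₂) (hk1 : 0 < k₁) (hk2 : 0 < k₂) (hk3 : 0 < k₃)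
    (hl : 0 < l) (S : BresseSetting ρ₁ ρ₂ k₁ k₂ k₃ l L β a₀ 2) : BrD where
  ρ₁ := ρ₁
  ρ₂ := ρ₂
  k₁ := k₁
  k₂ := k₂
  k₃ := k₃
  l := l
  hρ₁ := hrho1
  hρ₂ := hrho2
  hk₁ := hk1
  hk₂ := hk2
  hk₃ := hk3
  hl := hl
  lam := S.lam
  lam_ne := S.lam_ne
  lam_tendsto := S.lam_tendsto
  u1 n := brE L (S.v1 n)
  p1 n := brE L (derivWithin (S.v1 n) (Icc 0 L))
  u3 n := brE L (S.v3 n)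
  p3 n := brE L (derivWithin (S.v3 n) (Icc 0 L))
  u5 n := brE L (S.v5 n)
  p5 n := brE L (derivWithin (S.v5 n) (Icc 0 L))
  f1 n := brE L (S.f1 n)
  g1 n := brE L (derivWithin (S.f1 n) (Icc 0 L))
  f3 n := brE L (S.f3 n)
  g3 n := brE L (derivWithin (S.f3 n) (Icc 0 L))
  f5 n := brE L (S.f5 n)
  g5 n := brE L (derivWithin (S.f5 n) (Icc 0 L))
  f2 n := brE L (S.f2 n)
  f4 n := brE L (S.f4 n)
  f6 n := brE L (S.f6 n)

variable (hrho1 : 0 < ρ₁) (hrho2 : 0 < ρ₂) (hk1 : 0 < k₁) (hk2 : 0 < k₂) (hk3 : 0 < k₃)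
    (hl : 0 < l) (S : BresseSetting ρ₁ ρ₂ k₁ k₂ k₃ l L β a₀ 2)

lemma brMk_zpow (n : ℕ) : (S.lam n : ℂ) ^ (-((2 : ℕ) : ℤ)) =
    ((brMk hrho1 hrho2 hk1 hk2 hk3 hl S).mu n : ℂ) ^ 2 := by
  rw [zpow_neg, zpow_natCast]
  simp [BrD.mu, brMk]

lemma brMk_raw (hbeta : 0 < β) (hbetaL : β < L) (n : ℕ) (x : ℝ)
    (hx : x ∈ Ioo (0 : ℝ) β ∪ Ioo β L) :
    let D := brMk hrho1 hrho2 hk1 hk2 hk3 hl S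
    x ∈ Ioo 0 L ∧ D.u1 n x = S.v1 n x ∧ D.u3 n x = S.v3 n x ∧ D.u5 n x = S.v5 n x ∧
    D.p1 n x = deriv (S.v1 n) x ∧ D.p3 n x = deriv (S.v3 n) x ∧ D.p5 n x = deriv (S.v5 n) x ∧
    D.f1 n x = S.f1 n x ∧ D.f3 n x = S.f3 n x ∧ D.f5 n x = S.f5 n x ∧
    D.g1 n x = deriv (S.f1 n) x ∧ D.g3 n x = deriv (S.f3 n) x ∧ D.g5 n x = deriv (S.f5 n) x ∧
    D.f2 n x = S.f2 n x ∧ D.f4 n x = S.f4 n x ∧ D.f6 n x = S.f6 n x ∧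
    D.v2 n x = S.v2 n x ∧ D.v4 n x = S.v4 n x ∧ D.v6 n x = S.v6 n x := by
  intro D
  have hx' : x ∈ Ioo 0 L := by
    rcases hx with h | h
    · exact ⟨h.1, h.2.trans hbetaL⟩
    · exact ⟨hbeta.trans h.1, h.2⟩
  have hc : x ∈ Icc 0 L := ⟨hx'.1.le, hx'.2.le⟩
  have hz := brMk_zpow hrho1 hrho2 hk1 hk2 hk3 hl S n
  have e1 := S.eq1 n x hx
  have e3 := S.eq3 n x hx
  have e5 := S.eq5 n x hx
  rw [hz] at e1 e3 e5
  refine ⟨hx', brE_eq _ hc, brE_eq _ hc, brE_eq _ hc, brE_deq _ hx', brE_deq _ hx', brE_deq _ hx',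
    brE_eq _ hc, brE_eq _ hc, brE_eq _ hc, brE_deq _ hx', brE_deq _ hx', brE_deq _ hx',
    brE_eq _ hc, brE_eq _ hc, brE_eq _ hc, ?_, ?_, ?_⟩
  · have h1 : D.u1 n x = S.v1 n x := brE_eq _ hc
    have h2 : D.f1 n x = S.f1 n x := brE_eq _ hc
    have h3 : D.lam n = S.lam n := rfl
    rw [BrD.v2, h1, h2, h3]
    linear_combination e1
  · have h1 : D.u3 n x = S.v3 n x := brE_eq _ hc
    have h2 : D.f3 n x = S.f3 n x := brE_eq _ hc
    have h3 : D.lam n = S.lam n := rfl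
    rw [BrD.v4, h1, h2, h3]
    linear_combination e3
  · have h1 : D.u5 n x = S.v5 n x := brE_eq _ hc
    have h2 : D.f5 n x = S.f5 n x := brE_eq _ hc
    have h3 : D.lam n = S.lam n := rfl
    rw [BrD.v6, h1, h2, h3]
    linear_combination e5

lemma brMk_good (hL : 0 < L) (hbeta : 0 < β) (hbetaL : β < L) {a b α : ℝ} (ha : 0 ≤ a)
    (hab : a < b) (hb : b ≤ L) (hsub : Ioo a b ⊆ Ioo (0 : ℝ) β ∪ Ioo β L)
    (hreg : ∀ n, ContDiffOn ℝ 2 (S.v5 n) (Icc a b))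
    (hα : ∀ x ∈ Ioo a b, (if x < β then (a₀ : ℂ) else 0) = (α : ℂ)) :
    (brMk hrho1 hrho2 hk1 hk2 hk3 hl S).Good a b α := by
  have raw := brMk_raw hrho1 hrho2 hk1 hk2 hk3 hl S hbeta hbetaL
  have hz := brMk_zpow hrho1 hrho2 hk1 hk2 hk3 hl S
  set D := brMk hrho1 hrho2 hk1 hk2 hk3 hl S with hD
  have hlam : D.lam = S.lam := rfl
  have hr1 : D.ρ₁ = ρ₁ := rfl
  have hr2 : D.ρ₂ = ρ₂ := rfl
  have hkk1 : D.k₁ = k₁ := rfl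
  have hkk2 : D.k₂ = k₂ := rfl
  have hkk3 : D.k₃ = k₃ := rfl
  have hll : D.l = l := rfl
  have hk1c : (k₁ : ℂ) ≠ 0 := by exact_mod_cast hk1.ne'
  have hk2c : (k₂ : ℂ) ≠ 0 := by exact_mod_cast hk2.ne'
  have hk3c : (k₃ : ℂ) ≠ 0 := by exact_mod_cast hk3.ne'
  have r1 : ∀ n, ContDiffOn ℝ 1 (S.v1 n) (Icc 0 L) := fun n => (S.reg_v1 n).of_le (by norm_num)
  have r3 : ∀ n, ContDiffOn ℝ 1 (S.v3 n) (Icc 0 L) := fun n => (S.reg_v3 n).of_le (by norm_num)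
  have r5 := S.reg_v5
  have cu1 : ∀ n, Continuous (D.u1 n) := fun n => brE_cont hL.le (r1 n).continuousOn
  have cu3 : ∀ n, Continuous (D.u3 n) := fun n => brE_cont hL.le (r3 n).continuousOn
  have cu5 : ∀ n, Continuous (D.u5 n) := fun n => brE_cont hL.le (r5 n).continuousOn
  have cp1 : ∀ n, Continuous (D.p1 n) := fun n => brE_dcont hL (r1 n)
  have cp3 : ∀ n, Continuous (D.p3 n) := fun n => brE_dcont hL (r3 n)
  have cp5 : ∀ n, Continuous (D.p5 n) := fun n => brE_dcont hL (r5 n)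
  have cf1 : ∀ n, Continuous (D.f1 n) := fun n => brE_cont hL.le (S.reg_f1 n).continuousOn
  have cf3 : ∀ n, Continuous (D.f3 n) := fun n => brE_cont hL.le (S.reg_f3 n).continuousOn
  have cf5 : ∀ n, Continuous (D.f5 n) := fun n => brE_cont hL.le (S.reg_f5 n).continuousOn
  have cg1 : ∀ n, Continuous (D.g1 n) := fun n => brE_dcont hL (S.reg_f1 n)
  have cg3 : ∀ n, Continuous (D.g3 n) := fun n => brE_dcont hL (S.reg_f3 n)
  have cg5 : ∀ n, Continuous (D.g5 n) := fun n => brE_dcont hL (S.reg_f5 n)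
  have cf2 : ∀ n, Continuous (D.f2 n) := fun n => brE_cont hL.le (S.reg_f2 n)
  have cf4 : ∀ n, Continuous (D.f4 n) := fun n => brE_cont hL.le (S.reg_f4 n)
  have cf6 : ∀ n, Continuous (D.f6 n) := fun n => brE_cont hL.le (S.reg_f6 n)
  have cv2 : ∀ n, Continuous (D.v2 n) := fun n => by
    have h1 := cu1 n
    have h2 := cf1 n
    unfold BrD.v2; fun_prop
  have cv4 : ∀ n, Continuous (D.v4 n) := fun n => by
    have h1 := cu3 n
    have h2 := cf3 n
    unfold BrD.v4; fun_prop
  have cv6 : ∀ n, Continuous (D.v6 n) := fun n => by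
    have h1 := cu5 n
    have h2 := cf5 n
    unfold BrD.v6; fun_prop
  -- right-hand sides
  have hF : Tendsto (fun n => ∫ x in (0:ℝ)..L,
      (k₁ * ‖D.g1 n x + D.f3 n x + (l : ℂ) * D.f5 n x‖ ^ 2 + ρ₁ * ‖D.f2 n x‖ ^ 2
        + k₂ * ‖D.g3 n x‖ ^ 2 + ρ₂ * ‖D.f4 n x‖ ^ 2
        + k₃ * ‖D.g5 n x - (l : ℂ) * D.f1 n x‖ ^ 2 + ρ₁ * ‖D.f6 n x‖ ^ 2)) atTop (nhds 0) := by
    refine S.normF.congr (fun n => br_congr (β := β) le_rfl hL.le le_rfl (fun x hx => ?_))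
    obtain ⟨_, _, _, _, _, _, _, e1, e2, e3, e4, e5, e6, e7, e8, e9, _, _, _⟩ := raw n x hx
    rw [e1, e2, e3, e4, e5, e6, e7, e8, e9]
  have cEF : ∀ n, Continuous (fun x =>
      (k₁ * ‖D.g1 n x + D.f3 n x + (l : ℂ) * D.f5 n x‖ ^ 2 + ρ₁ * ‖D.f2 n x‖ ^ 2
        + k₂ * ‖D.g3 n x‖ ^ 2 + ρ₂ * ‖D.f4 n x‖ ^ 2
        + k₃ * ‖D.g5 n x - (l : ℂ) * D.f1 n x‖ ^ 2 + ρ₁ * ‖D.f6 n x‖ ^ 2)) := fun n => by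
    have h1 := cg1 n
    have h2 := cf3 n
    have h3 := cf5 n
    have h4 := cf2 n
    have h5 := cg3 n
    have h6 := cf4 n
    have h7 := cg5 n
    have h8 := cf1 n
    have h9 := cf6 n
    fun_prop
  have oΦ1 : Bro 0 L (fun n x => D.g1 n x + D.f3 n x + (l : ℂ) * D.f5 n x) :=
    Bro.of_le (A := fun n x => D.g1 n x + D.f3 n x + (l : ℂ) * D.f5 n x) hL.le hk1 (fun n => ((cg1 n).add (cf3 n)).add (continuous_const.mul (cf5 n))) cEF
      (fun n x => by apply br_six1 <;> positivity) hF
  have of2 : Bro 0 L D.f2 :=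
    Bro.of_le hL.le hrho1 cf2 cEF
      (fun n x => by apply br_six2 <;> positivity) hF
  have og3 : Bro 0 L D.g3 :=
    Bro.of_le hL.le hk2 cg3 cEF
      (fun n x => by apply br_six3 <;> positivity) hF
  have of4 : Bro 0 L D.f4 :=
    Bro.of_le hL.le hrho2 cf4 cEF
      (fun n x => by apply br_six4 <;> positivity) hF
  have oΦ5 : Bro 0 L (fun n x => D.g5 n x - (l : ℂ) * D.f1 n x) :=
    Bro.of_le (A := fun n x => D.g5 n x - (l : ℂ) * D.f1 n x) hL.le hk3 (fun n => (cg5 n).sub (continuous_const.mul (cf1 n))) cEF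
      (fun n x => by apply br_six5 <;> positivity) hF
  have of6 : Bro 0 L D.f6 :=
    Bro.of_le hL.le hrho1 cf6 cEF
      (fun n x => by apply br_six6 <;> positivity) hF
  have df1 : ∀ n, ∀ x ∈ Ioo 0 L, HasDerivAt (D.f1 n) (D.g1 n x) x :=
    fun n x hx => brE_deriv (S.reg_f1 n) hx
  have df3 : ∀ n, ∀ x ∈ Ioo 0 L, HasDerivAt (D.f3 n) (D.g3 n x) x :=
    fun n x hx => brE_deriv (S.reg_f3 n) hx
  have df5 : ∀ n, ∀ x ∈ Ioo 0 L, HasDerivAt (D.f5 n) (D.g5 n x) x :=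
    fun n x hx => brE_deriv (S.reg_f5 n) hx
  have h0L : (0:ℝ) ∈ Icc 0 L := ⟨le_rfl, hL.le⟩
  have z1 : ∀ n, D.f1 n 0 = 0 := fun n => by
    have := (S.bc_zero n).2.2.2.2.2.2.1
    rw [← this]; exact brE_eq _ h0L
  have z3 : ∀ n, D.f3 n 0 = 0 := fun n => by
    have := (S.bc_zero n).2.2.2.2.2.2.2.1
    rw [← this]; exact brE_eq _ h0L
  have z5 : ∀ n, D.f5 n 0 = 0 := fun n => by
    have := (S.bc_zero n).2.2.2.2.2.2.2.2
    rw [← this]; exact brE_eq _ h0L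
  have of3 : Bro 0 L D.f3 := Bro.poincare (κ := 0) hL.le og3 cf3 z3 (fun n x hx => by
    simpa using df3 n x hx)
  have oyp : Bro 0 L (fun n x => D.f1 n x + Complex.I * D.f5 n x) := by
    refine Bro.poincare (κ := l) hL.le
      ((oΦ1.add hL.le (of3.smul hL.le (-1))).add hL.le (oΦ5.smul hL.le Complex.I))
      (fun n => (cf1 n).add (continuous_const.mul (cf5 n))) (fun n => by simp [z1, z5])
      (fun n x hx => ?_)
    refine ((df1 n x hx).add ((df5 n x hx).const_mul Complex.I)).congr_deriv ?_
    linear_combination (-(l : ℂ) * D.f5 n x) * Complex.I_mul_I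
  have oym : Bro 0 L (fun n x => D.f1 n x + (-Complex.I) * D.f5 n x) := by
    refine Bro.poincare (κ := -l) hL.le
      ((oΦ1.add hL.le (of3.smul hL.le (-1))).add hL.le (oΦ5.smul hL.le (-Complex.I)))
      (fun n => (cf1 n).add (continuous_const.mul (cf5 n))) (fun n => by simp [z1, z5])
      (fun n x hx => ?_)
    refine ((df1 n x hx).add ((df5 n x hx).const_mul (-Complex.I))).congr_deriv ?_
    push_cast
    linear_combination (-(l : ℂ) * D.f5 n x) * Complex.I_mul_I
  have of1 : Bro 0 L D.f1 := ((oyp.add hL.le oym).smul hL.le (1/2)).congr (fun n x => by ring)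
  have of5 : Bro 0 L D.f5 := ((oyp.add hL.le (oym.smul hL.le (-1))).smul hL.le
    (-Complex.I/2)).congr (fun n x => by
      linear_combination (D.f5 n x) * Complex.I_mul_I)
  have og1 : Bro 0 L D.g1 := ((oΦ1.add hL.le (of3.smul hL.le (-1))).add hL.le
    (of5.smul hL.le (-l : ℂ))).congr (fun n x => by ring)
  have og5 : Bro 0 L D.g5 := (oΦ5.add hL.le (of1.smul hL.le (l : ℂ))).congr (fun n x => by ring)
  -- solutions
  have hU : ∀ n, ∫ x in (0:ℝ)..L,
      (k₁ * ‖D.p1 n x + D.u3 n x + (l : ℂ) * D.u5 n x‖ ^ 2 + ρ₁ * ‖D.v2 n x‖ ^ 2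
        + k₂ * ‖D.p3 n x‖ ^ 2 + ρ₂ * ‖D.v4 n x‖ ^ 2
        + k₃ * ‖D.p5 n x - (l : ℂ) * D.u1 n x‖ ^ 2 + ρ₁ * ‖D.v6 n x‖ ^ 2) = 1 := by
    intro n
    rw [← S.normU n]
    refine br_congr (β := β) le_rfl hL.le le_rfl (fun x hx => ?_)
    obtain ⟨_, e1, e2, e3, e4, e5, e6, _, _, _, _, _, _, _, _, _, e7, e8, e9⟩ := raw n x hx
    rw [e1, e2, e3, e4, e5, e6, e7, e8, e9]
  have cEU : ∀ n, Continuous (fun x =>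
      (k₁ * ‖D.p1 n x + D.u3 n x + (l : ℂ) * D.u5 n x‖ ^ 2 + ρ₁ * ‖D.v2 n x‖ ^ 2
        + k₂ * ‖D.p3 n x‖ ^ 2 + ρ₂ * ‖D.v4 n x‖ ^ 2
        + k₃ * ‖D.p5 n x - (l : ℂ) * D.u1 n x‖ ^ 2 + ρ₁ * ‖D.v6 n x‖ ^ 2)) := fun n => by
    have h1 := cp1 n
    have h2 := cu3 n
    have h3 := cu5 n
    have h4 := cv2 n
    have h5 := cp3 n
    have h6 := cv4 n
    have h7 := cp5 n
    have h8 := cu1 n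
    have h9 := cv6 n
    fun_prop
  have OT1 : BrO 0 L (fun n x => D.p1 n x + D.u3 n x + (l : ℂ) * D.u5 n x) :=
    BrO.of_le (A := fun n x => D.p1 n x + D.u3 n x + (l : ℂ) * D.u5 n x) hL.le hk1 (fun n => ((cp1 n).add (cu3 n)).add (continuous_const.mul (cu5 n))) cEU
      (fun n x => by apply br_six1 <;> positivity) hU
  have Ov2 : BrO 0 L D.v2 :=
    BrO.of_le hL.le hrho1 cv2 cEU
      (fun n x => by apply br_six2 <;> positivity) hU
  have Op3 : BrO 0 L D.p3 :=
    BrO.of_le hL.le hk2 cp3 cEU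
      (fun n x => by apply br_six3 <;> positivity) hU
  have Ov4 : BrO 0 L D.v4 :=
    BrO.of_le hL.le hrho2 cv4 cEU
      (fun n x => by apply br_six4 <;> positivity) hU
  have OT5 : BrO 0 L (fun n x => D.p5 n x - (l : ℂ) * D.u1 n x) :=
    BrO.of_le (A := fun n x => D.p5 n x - (l : ℂ) * D.u1 n x) hL.le hk3 (fun n => (cp5 n).sub (continuous_const.mul (cu1 n))) cEU
      (fun n x => by apply br_six5 <;> positivity) hU
  have Ov6 : BrO 0 L D.v6 :=
    BrO.of_le hL.le hrho1 cv6 cEU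
      (fun n x => by apply br_six6 <;> positivity) hU
  have mm : ∀ {A : ℕ → ℝ → ℂ}, BrO 0 L A → BrO 0 L (fun n x => (D.mu n : ℂ) * A n x) :=
    fun h => (h.small hL.le D.mu_tendsto).toO
  have Ou1 : BrO 0 L D.u1 := by
    refine ((mm (Ov2.add hL.le (mm (mm of1.toO)))).smul hL.le (-Complex.I)).congr
      (fun n x => ?_)
    simp only [BrD.v2]
    linear_combination (D.lam n * D.mu n * D.u1 n x) * Complex.I_mul_I
      - D.u1 n x * D.lam_mu n
  have Ou3 : BrO 0 L D.u3 := by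
    refine ((mm (Ov4.add hL.le (mm (mm of3.toO)))).smul hL.le (-Complex.I)).congr
      (fun n x => ?_)
    simp only [BrD.v4]
    linear_combination (D.lam n * D.mu n * D.u3 n x) * Complex.I_mul_I
      - D.u3 n x * D.lam_mu n
  have Ou5 : BrO 0 L D.u5 := by
    refine ((mm (Ov6.add hL.le (mm (mm of5.toO)))).smul hL.le (-Complex.I)).congr
      (fun n x => ?_)
    simp only [BrD.v6]
    linear_combination (D.lam n * D.mu n * D.u5 n x) * Complex.I_mul_I
      - D.u5 n x * D.lam_mu n
  have Op1 : BrO 0 L D.p1 := ((OT1.add hL.le (Ou3.smul hL.le (-1))).add hL.le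
    (Ou5.smul hL.le (-l : ℂ))).congr (fun n x => by ring)
  have Op5 : BrO 0 L D.p5 := (OT5.add hL.le (Ou1.smul hL.le (l : ℂ))).congr (fun n x => by ring)
  have hIoo : ∀ x ∈ Ioo a b, x ∈ Ioo 0 L := fun x hx => (raw 0 x (hsub hx)).1
  have hIcc : Icc a b ⊆ Icc 0 L := Icc_subset_Icc ha hb
  refine
  { hab := hab
    du1 := fun n x hx => brE_deriv (r1 n) (hIoo x hx)
    du3 := fun n x hx => brE_deriv (r3 n) (hIoo x hx)
    du5 := fun n x hx => brE_deriv (r5 n) (hIoo x hx)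
    dp1 := fun n x hx => ?_
    dp3 := fun n x hx => ?_
    dp5 := fun n x hx => ?_
    df1 := fun n x hx => df1 n x (hIoo x hx)
    df3 := fun n x hx => df3 n x (hIoo x hx)
    df5 := fun n x hx => df5 n x (hIoo x hx)
    cu1 := cu1
    cu3 := cu3
    cu5 := cu5
    Ov2 := Ov2.mono ha hab.le hb
    Ov4 := Ov4.mono ha hab.le hb
    Ov6 := Ov6.mono ha hab.le hb
    Op1 := Op1.mono ha hab.le hb
    Op3 := Op3.mono ha hab.le hb
    Op5 := Op5.mono ha hab.le hb
    of1 := of1.mono ha hab.le hb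
    of2 := of2.mono ha hab.le hb
    of3 := of3.mono ha hab.le hb
    of4 := of4.mono ha hab.le hb
    of5 := of5.mono ha hab.le hb
    of6 := of6.mono ha hab.le hb
    og1 := og1.mono ha hab.le hb
    og3 := og3.mono ha hab.le hb
    og5 := og5.mono ha hab.le hb }
  · have h2 := brE_deriv2 ha hb ((S.reg_v1 n).mono hIcc) hx
    refine h2.congr_deriv ?_
    have hx' := hIoo x hx
    have e := S.eq2 n x (hsub hx)
    have d1 := (brE_diff2 ((S.reg_v1 n).mono hIcc) hx).hasDerivAt
    have d3 := (brE_diff (r3 n) hx').hasDerivAt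
    have d5 := (brE_diff (r5 n) hx').hasDerivAt
    have dd : deriv (fun y => deriv (S.v1 n) y + S.v3 n y + (l : ℂ) * S.v5 n y) x =
        deriv (deriv (S.v1 n)) x + deriv (S.v3 n) x + l * deriv (S.v5 n) x :=
      ((d1.add d3).add (d5.const_mul (l : ℂ))).deriv
    obtain ⟨_, e1, e2, e3, e4, e5, e6, q1, q2, q3, _, _, _, q4, q5, q6, e7, e8, e9⟩ :=
      raw n x (hsub hx)
    rw [dd, hz n] at e
    rw [hkk1, eq_inv_mul_iff_mul_eq₀ hk1c]
    simp only [BrD.s1, BrD.r1, hkk1, hkk3, hll, hr1, hlam, e1, e5, e6, q1, q4]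
    rw [← e7, BrD.v2, e1, q1, hlam] at e
    have hlm := D.lam_mu n
    rw [hlam] at hlm
    linear_combination (-1 : ℂ) * e + (ρ₁ * S.lam n ^ 2 * S.v1 n x) * Complex.I_mul_I
      - (Complex.I * ρ₁ * D.mu n * S.f1 n x) * hlm
  · have h2 := brE_deriv2 ha hb ((S.reg_v3 n).mono hIcc) hx
    refine h2.congr_deriv ?_
    have hx' := hIoo x hx
    have e := S.eq4 n x (hsub hx)
    obtain ⟨_, e1, e2, e3, e4, e5, e6, q1, q2, q3, _, _, _, q4, q5, q6, e7, e8, e9⟩ :=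
      raw n x (hsub hx)
    rw [hz n] at e
    rw [hkk2, eq_inv_mul_iff_mul_eq₀ hk2c]
    simp only [BrD.s3, BrD.r3, hkk1, hll, hr2, hlam, e2, e3, e4, q2, q5]
    rw [← e8, BrD.v4, e2, q2, hlam] at e
    have hlm := D.lam_mu n
    rw [hlam] at hlm
    linear_combination (-1 : ℂ) * e + (ρ₂ * S.lam n ^ 2 * S.v3 n x) * Complex.I_mul_I
      - (Complex.I * ρ₂ * D.mu n * S.f3 n x) * hlm
  · have h2 := brE_deriv2 ha hb (hreg n) hx
    refine h2.congr_deriv ?_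
    have hx' := hIoo x hx
    have e := S.eq6 n x (hsub hx)
    have d5 := (brE_diff2 (hreg n) hx).hasDerivAt
    have d1 := (brE_diff (r1 n) hx').hasDerivAt
    have dd : deriv (fun y => deriv (S.v5 n) y - (l : ℂ) * S.v1 n y) x =
        deriv (deriv (S.v5 n)) x - l * deriv (S.v1 n) x :=
      (d5.sub (d1.const_mul (l : ℂ))).deriv
    obtain ⟨_, e1, e2, e3, e4, e5, e6, q1, q2, q3, _, _, _, q4, q5, q6, e7, e8, e9⟩ :=
      raw n x (hsub hx)
    rw [dd, hz n, hα x hx] at e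
    rw [hkk3, eq_inv_mul_iff_mul_eq₀ hk3c]
    simp only [BrD.s5, BrD.r5, BrD.v6, hkk1, hkk3, hll, hr1, hlam, e2, e3, e4, q3, q6]
    rw [← e9, BrD.v6, e3, q3, hlam] at e
    have hlm := D.lam_mu n
    rw [hlam] at hlm
    linear_combination (-1 : ℂ) * e + (ρ₁ * S.lam n ^ 2 * S.v5 n x) * Complex.I_mul_I
      - (Complex.I * ρ₁ * D.mu n * S.f5 n x) * hlm

end Bridge

theorem bresse_lemma7_H2 (ρ₁ ρ₂ k₁ k₂ k₃ l L β a₀ : ℝ) (ℓ : ℕ)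
    (hrho1 : 0 < ρ₁) (hrho2 : 0 < ρ₂) (hk1 : 0 < k₁) (hk2 : 0 < k₂) (hk3 : 0 < k₃)
    (hl : 0 < l) (hL : 0 < L) (ha0 : 0 < a₀) (hbeta : 0 < β) (hbetaL : β < L)
    (S : BresseSetting ρ₁ ρ₂ k₁ k₂ k₃ l L β a₀ ℓ)
    (hH : k₁ / ρ₁ = k₂ / ρ₂ ∧ k₁ ≠ k₃ ∧ ℓ = 2) :
    ∀ ε : ℝ, 0 < ε → ε < β / 12 →
    Tendsto (fun n =>
      (∫ x in (0 : ℝ)..(5 * ε),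
        (ρ₁ * (S.lam n) ^ 2 * ‖S.v1 n x‖ ^ 2 + k₁ * ‖deriv (S.v1 n) x‖ ^ 2
          + ρ₂ * (S.lam n) ^ 2 * ‖S.v3 n x‖ ^ 2 + k₂ * ‖deriv (S.v3 n) x‖ ^ 2
          + k₃ * ‖deriv (S.v5 n) x‖ ^ 2))
      + (∫ x in (β - 5 * ε)..L,
        (ρ₁ * (S.lam n) ^ 2 * ‖S.v1 n x‖ ^ 2 + k₁ * ‖deriv (S.v1 n) x‖ ^ 2
          + ρ₂ * (S.lam n) ^ 2 * ‖S.v3 n x‖ ^ 2 + k₂ * ‖deriv (S.v3 n) x‖ ^ 2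
          + k₃ * ‖deriv (S.v5 n) x‖ ^ 2))
      + ρ₁ * (S.lam n) ^ 2 * ∫ x in β..L, ‖S.v5 n x‖ ^ 2) atTop (nhds 0) := by
  obtain ⟨hkk, -, rfl⟩ := hH
  intro ε hε hεβ
  have raw := brMk_raw hrho1 hrho2 hk1 hk2 hk3 hl S hbeta hbetaL
  have H : (brMk hrho1 hrho2 hk1 hk2 hk3 hl S).Good 0 β a₀ :=
    brMk_good hrho1 hrho2 hk1 hk2 hk3 hl S hL hbeta hbetaL le_rfl hbeta hbetaL.le
      (fun x hx => Or.inl hx) S.reg_v5_left (fun x hx => if_pos hx.2)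
  have H' : (brMk hrho1 hrho2 hk1 hk2 hk3 hl S).Good β L 0 :=
    brMk_good hrho1 hrho2 hk1 hk2 hk3 hl S hL hbeta hbetaL hbeta.le hbetaL le_rfl
      (fun x hx => Or.inr hx) S.reg_v5_right (fun x hx => by
        rw [if_neg (not_lt.2 hx.1.le)]; simp)
  set D := brMk hrho1 hrho2 hk1 hk2 hk3 hl S with hD
  have hB : ∀ n y, y ∈ Icc 0 L → S.v1 n y = 0 → S.v3 n y = 0 → S.v5 n y = 0 → S.f1 n y = 0 →
      S.f3 n y = 0 → S.f5 n y = 0 → D.Bd n y = 0 := by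
    intro n y hy h1 h3 h5 g1 g3 g5
    have e1 : D.u1 n y = 0 := (brE_eq _ hy).trans h1
    have e3 : D.u3 n y = 0 := (brE_eq _ hy).trans h3
    have e5 : D.u5 n y = 0 := (brE_eq _ hy).trans h5
    have e2 : D.f1 n y = 0 := (brE_eq _ hy).trans g1
    have e4 : D.f3 n y = 0 := (brE_eq _ hy).trans g3
    have e6 : D.f5 n y = 0 := (brE_eq _ hy).trans g5
    simp [BrD.Bd, BrD.v2, BrD.v4, BrD.v6, e1, e2, e3, e4, e5, e6, brIp]
  have hB0 : ∀ n, D.Bd n 0 = 0 := fun n => by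
    obtain ⟨b1, _, b3, _, b5, _, c1, c3, c5⟩ := S.bc_zero n
    exact hB n 0 ⟨le_rfl, hL.le⟩ b1 b3 b5 c1 c3 c5
  have hBL : ∀ n, D.Bd n L = 0 := fun n => by
    obtain ⟨b1, _, b3, _, b5, _, c1, c3, c5⟩ := S.bc_L n
    exact hB n L ⟨hL.le, le_rfl⟩ b1 b3 b5 c1 c3 c5
  have heq : D.k₁ * D.ρ₂ = D.k₂ * D.ρ₁ := by
    rw [div_eq_div_iff hrho1.ne' hrho2.ne'] at hkk
    exact hkk
  have tot := D.total ha0 H H' heq hB0 hBL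
  have hlam : D.lam = S.lam := rfl
  have hr1 : D.ρ₁ = ρ₁ := rfl
  have hr2 : D.ρ₂ = ρ₂ := rfl
  have hkk1 : D.k₁ = k₁ := rfl
  have hkk2 : D.k₂ = k₂ := rfl
  have hkk3 : D.k₃ = k₃ := rfl
  -- comparison on subintervals
  have key : ∀ n c d, 0 ≤ c → c ≤ d → d ≤ L → ∀ G G' : ℝ → ℝ, Continuous G' →
      (∀ x ∈ Ioo (0 : ℝ) β ∪ Ioo β L, G x = G' x) → (∀ x, 0 ≤ G' x) →
      (∀ x, G' x ≤ D.en n x) →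
      0 ≤ (∫ x in c..d, G x) ∧ (∫ x in c..d, G x) ≤ ∫ x in (0:ℝ)..L, D.en n x := by
    intro n c d hc hcd hd G G' hG' hGG h0 hle
    rw [br_congr hc hcd hd hGG]
    have ce := D.en_cont H n
    refine ⟨intervalIntegral.integral_nonneg hcd (fun x _ => h0 x), ?_⟩
    calc ∫ x in c..d, G' x ≤ ∫ x in c..d, D.en n x :=
          intervalIntegral.integral_mono_on hcd (hG'.intervalIntegrable _ _)
            (ce.intervalIntegrable _ _) (fun x _ => hle x)
      _ ≤ _ := intervalIntegral.integral_mono_interval hc hcd hd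
          (Eventually.of_forall fun x => (h0 x).trans (hle x)) (ce.intervalIntegrable _ _)
  have cG : ∀ n, Continuous (fun x => ρ₁ * (S.lam n) ^ 2 * ‖D.u1 n x‖ ^ 2 + k₁ * ‖D.p1 n x‖ ^ 2
      + ρ₂ * (S.lam n) ^ 2 * ‖D.u3 n x‖ ^ 2 + k₂ * ‖D.p3 n x‖ ^ 2 + k₃ * ‖D.p5 n x‖ ^ 2) := by
    intro n
    have c1 := H.cu1 n
    have c3 := H.cu3 n
    have d1 := H.Op1.1 n
    have d3 := H.Op3.1 n
    have d5 := H.Op5.1 n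
    fun_prop
  have hle : ∀ n x, ρ₁ * (S.lam n) ^ 2 * ‖D.u1 n x‖ ^ 2 + k₁ * ‖D.p1 n x‖ ^ 2
      + ρ₂ * (S.lam n) ^ 2 * ‖D.u3 n x‖ ^ 2 + k₂ * ‖D.p3 n x‖ ^ 2 + k₃ * ‖D.p5 n x‖ ^ 2
      ≤ D.en n x := by
    intro n x
    simp only [BrD.en, hlam, hr1, hr2, hkk1, hkk2, hkk3]
    have : 0 ≤ ρ₁ * S.lam n ^ 2 * ‖D.u5 n x‖ ^ 2 := by positivity
    linarith
  have hle5 : ∀ n x, ρ₁ * (S.lam n) ^ 2 * ‖D.u5 n x‖ ^ 2 ≤ D.en n x := by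
    intro n x
    simp only [BrD.en, hlam, hr1, hr2, hkk1, hkk2, hkk3]
    have : 0 ≤ ρ₁ * (S.lam n) ^ 2 * ‖D.u1 n x‖ ^ 2 + k₁ * ‖D.p1 n x‖ ^ 2
      + ρ₂ * (S.lam n) ^ 2 * ‖D.u3 n x‖ ^ 2 + k₂ * ‖D.p3 n x‖ ^ 2 + k₃ * ‖D.p5 n x‖ ^ 2 := by
      positivity
    linarith
  have I1 : ∀ n c d, 0 ≤ c → c ≤ d → d ≤ L → _ := fun n c d hc hcd hd =>
    key n c d hc hcd hd
      (fun x => ρ₁ * (S.lam n) ^ 2 * ‖S.v1 n x‖ ^ 2 + k₁ * ‖deriv (S.v1 n) x‖ ^ 2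
          + ρ₂ * (S.lam n) ^ 2 * ‖S.v3 n x‖ ^ 2 + k₂ * ‖deriv (S.v3 n) x‖ ^ 2
          + k₃ * ‖deriv (S.v5 n) x‖ ^ 2) _ (cG n) (fun x hx => by
        obtain ⟨_, e1, e2, e3, e4, e5, e6, _⟩ := raw n x hx
        rw [e1, e2, e4, e5, e6]) (fun x => by positivity) (hle n)
  have I5 := fun n => key n β L hbeta.le hbetaL.le le_rfl
      (fun x => ρ₁ * (S.lam n) ^ 2 * ‖S.v5 n x‖ ^ 2)
      (fun x => ρ₁ * (S.lam n) ^ 2 * ‖D.u5 n x‖ ^ 2)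
      (continuous_const.mul ((H.cu5 n).norm.pow 2)) (fun x hx => by
        obtain ⟨_, e1, e2, e3, e4, e5, e6, _⟩ := raw n x hx
        rw [e3]) (fun x => by positivity) (hle5 n)
  have tot3 := tot.const_mul 3
  rw [mul_zero] at tot3
  refine squeeze_zero (fun n => ?_) (fun n => ?_) tot3
  · have a1 := (I1 n 0 (5 * ε) le_rfl (by linarith) (by linarith)).1
    have a2 := (I1 n (β - 5 * ε) L (by linarith) (by linarith) le_rfl).1
    have a3 := (I5 n).1
    rw [intervalIntegral.integral_const_mul] at a3
    exact add_nonneg (add_nonneg a1 a2) a3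
  · have a1 := (I1 n 0 (5 * ε) le_rfl (by linarith) (by linarith)).2
    have a2 := (I1 n (β - 5 * ε) L (by linarith) (by linarith) le_rfl).2
    have a3 := (I5 n).2
    rw [intervalIntegral.integral_const_mul] at a3
    linarith
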